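/- arXiv:0803.2424 — 5 statements merged into one kernel-verified Lean document; each statement's English description precedes it below -/
import Mathlib

section
/- (Glimm–Effros) Let X be a Polish space and T : X → X an aperiodic homeomorphism. Then the following are equivalent: (i) T has a recurrent point, i.e. a point x with x = lim_{i→∞} T^{nᵢ}x for some strictly increasing sequence n₁ < n₂ < ⋯; (ii) there is a T-orbit which is not locally closed; (iii) there is no Borel set which intersects each T-orbit exactly once; (iv) there is a non-atomic Borel probability measure μ on X which is T-quasi-invariant and with respect to which T is ergodic. -/
open MeasureTheory Set Filter ENNReal Topology

/-- `T` is quasi-invariant (nonsingular) w.r.t. `μ`. -/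
def QuasiInvariant' {X : Type*} [MeasurableSpace X] (μ : Measure X) (T : X → X) : Prop :=
  ∀ N : Set X, MeasurableSet N → (μ (T ⁻¹' N) = 0 ↔ μ N = 0)

/-- `T` is *ergodic* w.r.t. `μ`. -/
def Ergodic' {X : Type*} [MeasurableSpace X] (μ : Measure X) (T : X → X) : Prop :=
  ∀ A : Set X, MeasurableSet A → T ⁻¹' A = A → μ A = 0 ∨ μ Aᶜ = 0

/-- The (full, two-sided) `T`-orbit of a point `x`. -/
def orbit {X : Type*} [TopologicalSpace X] (T : X ≃ₜ X) (x : X) : Set X :=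
  Set.range fun k : ℤ => ((T.toEquiv : Equiv.Perm X) ^ k) x

section Orbits

variable {X : Type*} [TopologicalSpace X]

lemma Homeomorph.toPerm_zpow_apply (T : X ≃ₜ X) (k : ℤ) (x : X) :
    ((T.toEquiv : Equiv.Perm X) ^ k) x = (T ^ k) x := by
  let φ : (X ≃ₜ X) →* Equiv.Perm X :=
    { toFun := fun f => f.toEquiv, map_one' := rfl, map_mul' := fun _ _ => rfl }
  exact (DFunLike.congr_fun (map_zpow φ T k) x).symm

lemma Homeomorph.zpow_natCast_apply (T : X ≃ₜ X) (n : ℕ) (x : X) :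
    (T ^ (n : ℤ)) x = T^[n] x := by
  induction n generalizing x with
  | zero => rfl
  | succ n ih => rw [Nat.cast_succ, zpow_add_one, Function.iterate_succ_apply, ← ih]; rfl

lemma Homeomorph.zpow_add_apply (T : X ≃ₜ X) (j k : ℤ) (x : X) :
    (T ^ (j + k)) x = (T ^ j) ((T ^ k) x) := by
  rw [zpow_add]; rfl

lemma mem_orbit_iff {T : X ≃ₜ X} {x y : X} : y ∈ orbit T x ↔ ∃ k : ℤ, (T ^ k) x = y := by
  simp [orbit, Homeomorph.toPerm_zpow_apply]

lemma zpow_apply_mem_orbit (T : X ≃ₜ X) (k : ℤ) (x : X) : (T ^ k) x ∈ orbit T x :=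
  mem_orbit_iff.2 ⟨k, rfl⟩

lemma mem_orbit_self' (T : X ≃ₜ X) (x : X) : x ∈ orbit T x := zpow_apply_mem_orbit T 0 x

lemma countable_orbit (T : X ≃ₜ X) (x : X) : (orbit T x).Countable := countable_range _

lemma orbit_zpow_apply (T : X ≃ₜ X) (k : ℤ) (x : X) : orbit T ((T ^ k) x) = orbit T x := by
  ext y
  simp only [mem_orbit_iff, ← Homeomorph.zpow_add_apply]
  exact ⟨fun ⟨j, hj⟩ => ⟨j + k, hj⟩, fun ⟨j, hj⟩ => ⟨j - k, by simpa using hj⟩⟩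

lemma orbit_eq_of_mem {T : X ≃ₜ X} {x y : X} (h : y ∈ orbit T x) : orbit T y = orbit T x := by
  obtain ⟨k, rfl⟩ := mem_orbit_iff.1 h
  exact orbit_zpow_apply T k x

lemma zpow_mem_iff_of_preimage_eq {T : X ≃ₜ X} {A : Set X} (hA : T ⁻¹' A = A) (k : ℤ) (x : X) :
    (T ^ k) x ∈ A ↔ x ∈ A := by
  have h1 : ∀ y, T y ∈ A ↔ y ∈ A := fun y => by
    conv_rhs => rw [← hA]
    rfl
  have h2 : ∀ y, T⁻¹ y ∈ A ↔ y ∈ A := fun y => by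
    rw [← h1 (T⁻¹ y)]; simp
  induction k with
  | zero => rfl
  | succ n ih =>
    rw [add_comm, Homeomorph.zpow_add_apply, zpow_one, h1]; exact ih
  | pred n ih =>
    rw [sub_eq_neg_add, Homeomorph.zpow_add_apply, zpow_neg_one, h2]; exact ih

lemma zpow_apply_ne {T : X ≃ₜ X} (hap : ∀ x : X, ∀ n : ℕ, 0 < n → T^[n] x ≠ x) {k : ℤ}
    (hk : k ≠ 0) (x : X) : (T ^ k) x ≠ x := by
  obtain ⟨n, rfl | rfl⟩ := k.eq_nat_or_neg
  · rw [Homeomorph.zpow_natCast_apply]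
    exact hap x n (by omega)
  · intro h
    apply hap x n (by omega)
    conv_lhs => rw [← h]
    rw [← Homeomorph.zpow_natCast_apply, ← Homeomorph.zpow_add_apply]
    simp

lemma zpow_apply_injective {T : X ≃ₜ X} (hap : ∀ x : X, ∀ n : ℕ, 0 < n → T^[n] x ≠ x) (x : X) :
    Function.Injective fun k : ℤ => (T ^ k) x := by
  intro j k h
  by_contra hne
  refine zpow_apply_ne hap (k := -k + j) (by omega) x ?_
  rw [Homeomorph.zpow_add_apply]
  simp only at h
  rw [h, ← Homeomorph.zpow_add_apply]
  simp

end Orbits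

section Recurrence

variable {X : Type*} [TopologicalSpace X]

/-- `x` is an accumulation point of its own two-sided orbit (in terms of times). -/
def TwoSidedRecurrent (T : X ≃ₜ X) (x : X) : Prop :=
  ∀ U ∈ 𝓝 x, ∃ k : ℤ, k ≠ 0 ∧ (T ^ k) x ∈ U

/-- `x` is the limit of a subsequence of its forward orbit. -/
def ForwardRecurrent (T : X ≃ₜ X) (x : X) : Prop :=
  ∃ n : ℕ → ℕ, StrictMono n ∧ Tendsto (fun i => T^[n i] x) atTop (𝓝 x)

lemma ForwardRecurrent.exists_ge {T : X ≃ₜ X} {x : X} (h : ForwardRecurrent T x) {U : Set X}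
    (hU : U ∈ 𝓝 x) (N : ℕ) : ∃ n ≥ N, T^[n] x ∈ U := by
  obtain ⟨n, hn, hlim⟩ := h
  obtain ⟨i, hi, hi'⟩ := ((hlim.eventually_mem hU).and (eventually_ge_atTop N)).exists
  exact ⟨n i, hi'.trans hn.le_apply, hi⟩

lemma TwoSidedRecurrent.of_not_isLocallyClosed [T1Space X] {T : X ≃ₜ X} {x : X}
    (h : ¬ IsLocallyClosed (orbit T x)) : TwoSidedRecurrent T x := by
  by_contra hx
  simp only [TwoSidedRecurrent, not_forall, not_exists, not_and] at hx
  obtain ⟨U, hU, hxU⟩ := hx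
  obtain ⟨V, hVU, hV, hxV⟩ := mem_nhds_iff.1 hU
  refine h ⟨⋃ k : ℤ, (T ^ k) ⁻¹' V, closure (orbit T x),
    isOpen_iUnion fun k => hV.preimage (T ^ k).continuous, isClosed_closure, ?_⟩
  apply Subset.antisymm
  · refine subset_inter (fun y hy => ?_) subset_closure
    obtain ⟨k, rfl⟩ := mem_orbit_iff.1 hy
    refine mem_iUnion.2 ⟨-k, ?_⟩
    rw [mem_preimage, ← Homeomorph.zpow_add_apply]
    simpa using hxV
  · rintro y ⟨hy, hyc⟩
    obtain ⟨k, hk⟩ := mem_iUnion.1 hy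
    have hcl : (T ^ k) y ∈ closure ({x} : Set X) := by
      rw [mem_closure_iff]
      intro W hW hyW
      obtain ⟨z, ⟨hzV, hzW⟩, hz⟩ := mem_closure_iff.1 hyc ((T ^ k) ⁻¹' (V ∩ W))
        ((hV.inter hW).preimage (T ^ k).continuous) ⟨hk, hyW⟩
      obtain ⟨j, rfl⟩ := mem_orbit_iff.1 hz
      rw [← Homeomorph.zpow_add_apply] at hzV hzW
      by_cases hkj : k + j = 0
      · rw [hkj] at hzW
        exact ⟨x, hzW, rfl⟩
      · exact absurd (hVU hzV) (hxU _ hkj)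
    rw [closure_singleton, mem_singleton_iff] at hcl
    refine mem_orbit_iff.2 ⟨-k, ?_⟩
    rw [← hcl, ← Homeomorph.zpow_add_apply]
    simp

lemma ForwardRecurrent.not_isLocallyClosed [PolishSpace X] {T : X ≃ₜ X}
    (hap : ∀ x : X, ∀ n : ℕ, 0 < n → T^[n] x ≠ x) {x : X} (h : ForwardRecurrent T x) :
    ¬ IsLocallyClosed (orbit T x) := by
  rintro ⟨V, F, hV, hF, hVF⟩
  have : PolishSpace F := hF.polishSpace
  have hOF : orbit T x ⊆ F := hVF ▸ inter_subset_right
  have hOV : orbit T x ⊆ V := hVF ▸ inter_subset_left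
  have hdense : Dense (⋂ k : ℤ, ({⟨(T ^ k) x, hOF (zpow_apply_mem_orbit T k x)⟩}ᶜ : Set F)) := by
    refine dense_iInter_of_isOpen (fun k => isOpen_compl_singleton) fun k => ?_
    intro y
    rw [mem_closure_iff]
    intro W hW hyW
    by_cases hy : y = ⟨(T ^ k) x, hOF (zpow_apply_mem_orbit T k x)⟩
    · subst hy
      obtain ⟨W', hW', rfl⟩ := isOpen_induced_iff.1 hW
      obtain ⟨n, hn, hnW⟩ := h.exists_ge
        ((hW'.preimage (T ^ k).continuous).mem_nhds (mem_preimage.2 hyW)) 1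
      rw [← Homeomorph.zpow_natCast_apply, mem_preimage, ← Homeomorph.zpow_add_apply] at hnW
      refine ⟨⟨_, hOF (zpow_apply_mem_orbit T (k + n) x)⟩, hnW, fun heq => ?_⟩
      have := zpow_apply_injective hap x (congrArg Subtype.val heq)
      omega
    · exact ⟨y, hyW, hy⟩
  obtain ⟨y, hyV, hy⟩ := hdense.inter_open_nonempty ((↑) ⁻¹' V)
    (hV.preimage continuous_subtype_val)
    ⟨⟨x, hOF (mem_orbit_self' T x)⟩, hOV (mem_orbit_self' T x)⟩
  have hyO : (y : X) ∈ orbit T x := hVF ▸ ⟨hyV, y.2⟩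
  obtain ⟨k, hk⟩ := mem_orbit_iff.1 hyO
  exact mem_iInter.1 hy k (Subtype.ext hk.symm)

lemma exists_forwardRecurrent_of_frequent [PolishSpace X] {T : X ≃ₜ X}
    (hap : ∀ x : X, ∀ n : ℕ, 0 < n → T^[n] x ≠ x) {x : X}
    (h : ∀ U ∈ 𝓝 x, ∃ n : ℕ, 0 < n ∧ T^[n] x ∈ U) : ForwardRecurrent T x := by
  have hge : ∀ N : ℕ, ∀ U ∈ 𝓝 x, ∃ n > N, T^[n] x ∈ U := by
    intro N U hU
    have hfin : (⋂ m ∈ Finset.Icc 1 N, ({T^[m] x}ᶜ : Set X)) ∈ 𝓝 x := by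
      refine (Filter.biInter_finset_mem _).2 fun m hm => ?_
      exact isOpen_compl_singleton.mem_nhds fun hx =>
        hap x m (Finset.mem_Icc.1 hm).1 (mem_singleton_iff.1 hx).symm
    obtain ⟨n, hn, hnU, hnF⟩ := h _ (inter_mem hU hfin)
    refine ⟨n, ?_, hnU⟩
    by_contra hN
    exact mem_iInter₂.1 hnF n (Finset.mem_Icc.2 ⟨hn, by omega⟩) rfl
  obtain ⟨U, hU⟩ := (𝓝 x).exists_antitone_basis
  choose φ hφ hφU using fun (i N : ℕ) => hge N (U i) (hU.mem i)
  let n : ℕ → ℕ := fun i => Nat.rec (φ 0 0) (fun i N => φ (i + 1) N) i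
  refine ⟨n, strictMono_nat_of_lt_succ fun i => hφ (i + 1) (n i), ?_⟩
  refine hU.tendsto fun i => ?_
  cases i with
  | zero => exact hφU 0 0
  | succ i => exact hφU (i + 1) (n i)

lemma TwoSidedRecurrent.exists_forwardRecurrent [PolishSpace X] {T : X ≃ₜ X}
    (hap : ∀ x : X, ∀ n : ℕ, 0 < n → T^[n] x ≠ x) {x : X} (h : TwoSidedRecurrent T x) :
    ∃ y, ForwardRecurrent T y := by
  let := TopologicalSpace.upgradeIsCompletelyMetrizable X
  let F := closure (orbit T x)
  have : PolishSpace F := isClosed_closure.polishSpace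
  let W : ℕ → Set F := fun N => ⋃ n : ℕ, ⋃ _ : 0 < n,
    {y : F | dist (T^[n] (y : X)) y < 1 / (N + 1)}
  have hdense : Dense (⋂ N, W N) := by
    refine dense_iInter_of_isOpen (fun N => ?_) fun N => ?_
    · refine isOpen_iUnion fun n => isOpen_iUnion fun _ => isOpen_lt ?_ continuous_const
      exact ((T.continuous.iterate n).comp continuous_subtype_val).dist continuous_subtype_val
    · intro y
      rw [Metric.mem_closure_iff]
      intro ε hε
      set δ := min ε (1 / (2 * ((N : ℝ) + 1)))
      have hδ0 : 0 < δ := lt_min hε (by positivity)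
      have hδN : δ + δ ≤ 1 / ((N : ℝ) + 1) := by
        have : δ ≤ 1 / (2 * ((N : ℝ) + 1)) := min_le_right _ _
        have h2 : 1 / (2 * ((N : ℝ) + 1)) + 1 / (2 * ((N : ℝ) + 1)) = 1 / ((N : ℝ) + 1) := by
          field_simp; norm_num
        linarith
      have key : ∃ (z : X) (n : ℕ), z ∈ orbit T x ∧ 0 < n ∧ dist z y < δ ∧
          dist (T^[n] z) y < δ := by
        obtain ⟨z, hz, hzd⟩ := Metric.mem_closure_iff.1 y.2 δ hδ0
        obtain ⟨j, rfl⟩ := mem_orbit_iff.1 hz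
        have hzd' : (T ^ j) x ∈ Metric.ball (y : X) δ := by rwa [Metric.mem_ball, dist_comm]
        obtain ⟨k, hk, hkU⟩ := h ((T ^ j) ⁻¹' Metric.ball (y : X) δ)
          ((Metric.isOpen_ball.preimage (T ^ j).continuous).mem_nhds hzd')
        rw [mem_preimage, ← Homeomorph.zpow_add_apply] at hkU
        obtain ⟨n, rfl | rfl⟩ := k.eq_nat_or_neg
        · refine ⟨_, n, zpow_apply_mem_orbit T j x, by omega, hzd', ?_⟩
          rw [← Homeomorph.zpow_natCast_apply, ← Homeomorph.zpow_add_apply, add_comm]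
          exact hkU
        · refine ⟨_, n, zpow_apply_mem_orbit T (j + -n) x, by omega, hkU, ?_⟩
          rw [← Homeomorph.zpow_natCast_apply, ← Homeomorph.zpow_add_apply]
          simpa using hzd'
      obtain ⟨z, n, hz, hn, hzy, hny⟩ := key
      refine ⟨⟨z, subset_closure hz⟩, ?_, ?_⟩
      · refine mem_iUnion₂.2 ⟨n, hn, ?_⟩
        calc dist (T^[n] z) z ≤ dist (T^[n] z) y + dist z y := dist_triangle_right _ _ _
          _ < δ + δ := add_lt_add hny hzy
          _ ≤ _ := hδN
      · rw [dist_comm]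
        exact lt_of_lt_of_le hzy (min_le_left _ _)
  have : Nonempty F := ⟨⟨x, subset_closure (mem_orbit_self' T x)⟩⟩
  obtain ⟨y, hy⟩ := hdense.nonempty
  refine ⟨y, exists_forwardRecurrent_of_frequent hap fun U hU => ?_⟩
  obtain ⟨ε, hε, hεU⟩ := Metric.mem_nhds_iff.1 hU
  obtain ⟨N, hN⟩ := exists_nat_one_div_lt hε
  obtain ⟨n, hn, hd⟩ := mem_iUnion₂.1 (mem_iInter.1 hy N)
  exact ⟨n, hn, hεU (lt_trans hd hN)⟩

end Recurrence

section Transversal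

variable {X : Type*} [TopologicalSpace X] [MeasurableSpace X] [BorelSpace X]

lemma exists_borel_transversal [SecondCountableTopology X] {T : X ≃ₜ X}
    (h : ∀ x, ¬ TwoSidedRecurrent T x) :
    ∃ B : Set X, MeasurableSet B ∧ ∀ x : X, ∃! y : X, y ∈ B ∩ orbit T x := by
  rcases isEmpty_or_nonempty X with hX | ⟨⟨x₀⟩⟩
  · exact ⟨∅, .empty, fun x => isEmptyElim x⟩
  have hb := TopologicalSpace.isBasis_countableBasis X
  obtain ⟨V₀, hV₀, -⟩ := hb.exists_subset_of_mem_open (mem_univ x₀) isOpen_univ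
  obtain ⟨U, hU⟩ := (TopologicalSpace.countable_countableBasis X).exists_eq_range ⟨V₀, hV₀⟩
  have hUo : ∀ n, IsOpen (U n) := fun n => hb.isOpen (hU ▸ mem_range_self n)
  let E : ℕ → Set X := fun n => U n ∩ ⋂ k : ℤ, ⋂ _ : k ≠ 0, (T ^ k) ⁻¹' (U n)ᶜ
  have hE : ∀ n, MeasurableSet (E n) := fun n =>
    (hUo n).measurableSet.inter <| .iInter fun k => .iInter fun _ =>
      (T ^ k).continuous.measurable (hUo n).measurableSet.compl
  let S : ℕ → Set X := fun n => ⋃ k : ℤ, (T ^ k) ⁻¹' E n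
  have hS : ∀ n, MeasurableSet (S n) := fun n =>
    .iUnion fun k => (T ^ k).continuous.measurable (hE n)
  have hES : ∀ n, E n ⊆ S n := fun n x hx => mem_iUnion.2 ⟨0, hx⟩
  have hSinv : ∀ n (k : ℤ) x, (T ^ k) x ∈ S n ↔ x ∈ S n := by
    intro n k x
    simp only [S, mem_iUnion, mem_preimage, ← Homeomorph.zpow_add_apply]
    exact ⟨fun ⟨j, hj⟩ => ⟨_, hj⟩, fun ⟨j, hj⟩ => ⟨j - k, by simpa using hj⟩⟩
  have hcover : ∀ x, ∃ n, x ∈ S n := by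
    intro x
    have hx := h x
    simp only [TwoSidedRecurrent, not_forall, not_exists, not_and] at hx
    obtain ⟨V, hV, hxV⟩ := hx
    obtain ⟨W, hW, hxW, hWV⟩ := hb.mem_nhds_iff.1 hV
    rw [hU] at hW
    obtain ⟨n, rfl⟩ := hW
    exact ⟨n, hES n ⟨hxW, mem_iInter₂.2 fun k hk hkU => hxV k hk (hWV hkU)⟩⟩
  refine ⟨⋃ n, E n \ ⋃ m, ⋃ _ : m < n, S m, .iUnion fun n => (hE n).diff <|
    .iUnion fun m => .iUnion fun _ => hS m, fun x => ?_⟩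
  classical
  have hmin : ∀ n (k : ℤ), (T ^ k) x ∈ E n \ ⋃ m, ⋃ _ : m < n, S m →
      n = Nat.find (hcover x) := by
    intro n k ⟨hkE, hkS⟩
    refine ((Nat.find_eq_iff _).2 ⟨(hSinv n k x).1 (hES n hkE), fun m hm hmS => ?_⟩).symm
    exact hkS (mem_iUnion₂.2 ⟨m, hm, (hSinv m k x).2 hmS⟩)
  obtain ⟨k, hk⟩ := mem_iUnion.1 (Nat.find_spec (hcover x))
  refine ⟨(T ^ k) x, ⟨mem_iUnion.2 ⟨Nat.find (hcover x), hk, fun hkS => ?_⟩,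
    zpow_apply_mem_orbit T k x⟩, ?_⟩
  · obtain ⟨m, hm, hmS⟩ := mem_iUnion₂.1 hkS
    exact Nat.find_min (hcover x) hm ((hSinv m k x).1 hmS)
  · rintro y ⟨hyB, hy⟩
    obtain ⟨j, rfl⟩ := mem_orbit_iff.1 hy
    obtain ⟨n, hn⟩ := mem_iUnion.1 hyB
    have hjE := hn.1
    rw [hmin n j hn] at hjE
    by_contra hne
    refine mem_iInter₂.1 hk.2 (j - k) (fun h0 => hne ?_) ?_
    · rw [sub_eq_zero.1 h0]
    · rw [← Homeomorph.zpow_add_apply]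
      simpa using hjE.1

lemma not_exists_borel_transversal_of_ergodic [PolishSpace X] {T : X ≃ₜ X} {μ : Measure X}
    [IsProbabilityMeasure μ] (hatom : ∀ x : X, μ {x} = 0) (herg : Ergodic' μ T) :
    ¬ ∃ B : Set X, MeasurableSet B ∧ ∀ x : X, ∃! y : X, y ∈ B ∩ orbit T x := by
  rintro ⟨B, hB, hBT⟩
  choose g hg hguniq using hBT
  have hgT : ∀ x, g (T x) = g x := fun x => by
    refine hguniq x _ ?_
    have := orbit_zpow_apply T 1 x
    rw [zpow_one] at this
    exact this ▸ hg (T x)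
  have : Nonempty X := μ.nonempty_of_neZero
  obtain ⟨y, hy⟩ := Filter.exists_eventuallyEq_const_of_forall_separating (l := ae μ) (f := g)
    MeasurableSet fun U hU => by
      have hpre : g ⁻¹' U = ⋃ k : ℤ, (T ^ k) ⁻¹' (B ∩ U) := by
        ext x
        simp only [mem_preimage, mem_iUnion]
        constructor
        · intro hx
          obtain ⟨k, hk⟩ := mem_orbit_iff.1 (hg x).2
          exact ⟨k, hk ▸ ⟨(hg x).1, hx⟩⟩
        · rintro ⟨k, hkB, hkU⟩
          rwa [← hguniq x _ ⟨hkB, zpow_apply_mem_orbit T k x⟩]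
      have hmeas : MeasurableSet (g ⁻¹' U) := by
        rw [hpre]
        exact .iUnion fun k => (T ^ k).continuous.measurable (hB.inter hU)
      rcases herg _ hmeas (by ext x; simp [hgT]) with h0 | h0
      · exact Or.inr (measure_eq_zero_iff_ae_notMem.1 h0)
      · exact Or.inl (by simpa using measure_eq_zero_iff_ae_notMem.1 h0)
  have hnull : μ (orbit T y) = 0 := by
    rw [← biUnion_of_singleton (orbit T y), measure_biUnion_null_iff (countable_orbit T y)]
    exact fun x _ => hatom x
  have hfull : ∀ᵐ x ∂μ, x ∈ orbit T y := by
    filter_upwards [hy] with x hx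
    have hyx : y ∈ orbit T x := by
      have := (hg x).2
      rwa [hx] at this
    rw [orbit_eq_of_mem hyx]
    exact mem_orbit_self' T x
  have hcompl : μ (orbit T y)ᶜ = 0 := hfull
  have huniv : μ univ ≤ 0 := by
    rw [← union_compl_self (orbit T y)]
    exact (measure_union_le _ _).trans (by simp [hnull, hcompl])
  simp at huniv

end Transversal

section CoinTossing

/-- The fair coin measure on `Bool`. -/
noncomputable def fairCoin : Measure Bool :=
  (2⁻¹ : ℝ≥0∞) • (Measure.dirac true + Measure.dirac false)

instance : IsProbabilityMeasure fairCoin :=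
  ⟨by simp [fairCoin, ← two_mul, ENNReal.mul_inv_cancel]⟩

lemma map_not_fairCoin : fairCoin.map not = fairCoin := by
  have h : Measurable not := measurable_of_finite _
  simp [fairCoin, Measure.map_smul, Measure.map_add _ _ h, Measure.map_dirac' h, add_comm]

/-- The law of a sequence of independent fair coin tosses. -/
noncomputable def coinTosses : Measure (ℕ → Bool) := Measure.infinitePi fun _ => fairCoin

instance : IsProbabilityMeasure coinTosses := by unfold coinTosses; infer_instance

/-- Flip the `i`-th term of a binary sequence. -/
def flipAt (i : ℕ) (s : ℕ → Bool) : ℕ → Bool := fun j => (if j = i then not else id) (s j)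

@[simp] lemma flipAt_self (i : ℕ) (s : ℕ → Bool) : flipAt i s i = !s i := by simp [flipAt]

lemma flipAt_of_ne {i j : ℕ} (h : j ≠ i) (s : ℕ → Bool) : flipAt i s j = s j := by
  simp [flipAt, h]

@[simp] lemma flipAt_flipAt (i : ℕ) (s : ℕ → Bool) : flipAt i (flipAt i s) = s := by
  ext j
  by_cases h : j = i <;> simp [flipAt, h]

lemma measurePreserving_flipAt (i : ℕ) : MeasurePreserving (flipAt i) coinTosses coinTosses := by
  have hm : ∀ j, Measurable (if j = i then not else id : Bool → Bool) :=
    fun j => measurable_of_finite _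
  refine ⟨measurable_pi_iff.2 fun j => (hm j).comp (measurable_pi_apply j), ?_⟩
  have := Measure.infinitePi_map_pi (fun _ : ℕ => fairCoin) hm
  rw [coinTosses]
  refine this.trans ?_
  congr 1
  ext1 j
  by_cases h : j = i
  · simp [h, map_not_fairCoin]
  · simp [h]

/-- Replace the first `n` terms of a binary sequence by `false`. -/
def clearBelow (n : ℕ) (s : ℕ → Bool) : ℕ → Bool := fun j => if j < n then false else s j

lemma clearBelow_succ (n : ℕ) (s : ℕ → Bool) :
    clearBelow (n + 1) s = clearBelow n s ∨ clearBelow (n + 1) s = flipAt n (clearBelow n s) := by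
  cases hs : s n with
  | false =>
    left
    ext j
    rcases lt_trichotomy j n with h | rfl | h
    · simp [clearBelow, h, h.trans (Nat.lt_succ_self n)]
    · simp [clearBelow, hs]
    · simp [clearBelow, h.not_gt, show ¬ j < n + 1 by omega]
  | true =>
    right
    ext j
    rcases lt_trichotomy j n with h | rfl | h
    · simp [clearBelow, flipAt, h, h.ne, h.trans (Nat.lt_succ_self n)]
    · simp [clearBelow, hs]
    · simp [clearBelow, flipAt, h.not_gt, h.ne', show ¬ j < n + 1 by omega]

/-- Zero-one law for sets of binary sequences invariant under changing finitely many terms. -/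
lemma coinTosses_eq_zero_or_one {A : Set (ℕ → Bool)} (hA : MeasurableSet A)
    (hflip : ∀ i s, flipAt i s ∈ A ↔ s ∈ A) : coinTosses A = 0 ∨ coinTosses A = 1 := by
  have hindep := ProbabilityTheory.iIndepFun_infinitePi (P := fun _ : ℕ => fairCoin)
    (X := fun _ => id) fun _ => measurable_id
  refine ProbabilityTheory.measure_zero_or_one_of_measurableSet_limsup_atTop
    (s := fun i => MeasurableSpace.comap (fun s : ℕ → Bool => s i) inferInstance)
    (fun i => (measurable_pi_apply i).comap_le) hindep ?_
  rw [limsup_eq_iInf_iSup_of_nat, MeasurableSpace.measurableSet_iInf]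
  intro n
  have hclear : clearBelow n ⁻¹' A = A := by
    ext s
    rw [mem_preimage]
    induction n with
    | zero => rfl
    | succ n ih =>
      rcases clearBelow_succ n s with h | h
      · rw [h]; exact ih
      · rw [h, hflip]; exact ih
  rw [← hclear]
  refine (@measurable_pi_iff _ _ _ (_) _ (clearBelow n)).2 (fun j => ?_) hA
  by_cases hj : j < n
  · simp only [clearBelow, hj, if_true]
    exact measurable_const
  · simp only [clearBelow, hj, if_false]
    refine (comap_measurable fun s : ℕ → Bool => s j).mono ?_ le_rfl
    exact le_iSup₂_of_le j (not_lt.1 hj) le_rfl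

end CoinTossing

section ErgodicMeasure

lemma ForwardRecurrent.exists_iterate_dist_lt {X : Type*} [PseudoMetricSpace X] {T : X ≃ₜ X}
    {x : X} (h : ForwardRecurrent T x) (N M : ℕ) {ε : ℝ} (hε : 0 < ε) :
    ∃ n ≥ N, ∀ m ≤ M, dist (T^[m] x) (T^[m + n] x) < ε := by
  have hU : (⋂ m ∈ Finset.range (M + 1), T^[m] ⁻¹' Metric.ball (T^[m] x) ε) ∈ 𝓝 x :=
    (Filter.biInter_finset_mem _).2 fun m _ =>
      (T.continuous.iterate m).continuousAt.preimage_mem_nhds (Metric.ball_mem_nhds _ hε)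
  obtain ⟨n, hn, hnU⟩ := h.exists_ge hU N
  refine ⟨n, hn, fun m hm => ?_⟩
  have := mem_iInter₂.1 hnU m (Finset.mem_range.2 (by omega))
  rwa [mem_preimage, ← Function.iterate_add_apply, Metric.mem_ball, dist_comm] at this

variable {X : Type*} [TopologicalSpace X]

/-- A recurrent point yields a Borel map from binary sequences along which changing one term
corresponds to moving along a `T`-orbit. -/
lemma ForwardRecurrent.exists_coding [PolishSpace X] [MeasurableSpace X] [BorelSpace X]
    {T : X ≃ₜ X} {x : X} (h : ForwardRecurrent T x) :
    ∃ (n : ℕ → ℕ) (f : (ℕ → Bool) → X), (∀ i, i ≤ n i) ∧ Measurable f ∧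
      ∀ i s, s i = false → f (flipAt i s) = (T ^ (n i : ℤ)) (f s) := by
  let := TopologicalSpace.upgradeIsCompletelyMetrizable X
  choose φ hφ hφd using fun i M : ℕ =>
    h.exists_iterate_dist_lt i M (show (0 : ℝ) < (1 / 2) ^ i by positivity)
  let a : ℕ → ℕ := fun i => Nat.rec 0 (fun i M => M + φ i M) i
  let n : ℕ → ℕ := fun i => φ i (a i)
  let e : ℕ → (ℕ → Bool) → ℕ := fun i s => ∑ j ∈ Finset.range i, if s j then n j else 0
  have he : ∀ i s, e i s ≤ a i := by
    intro i s
    induction i with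
    | zero => simp [e]
    | succ i ih =>
      have : e (i + 1) s = e i s + if s i then n i else 0 := Finset.sum_range_succ _ _
      rw [this]
      refine add_le_add ih ?_
      split_ifs
      · exact le_rfl
      · exact Nat.zero_le _
  have hcauchy : ∀ s, CauchySeq fun i => T^[e i s] x := by
    intro s
    refine cauchySeq_of_le_geometric (1 / 2) 1 (by norm_num) fun i => ?_
    have : e (i + 1) s = e i s + if s i then n i else 0 := Finset.sum_range_succ _ _
    rw [this, one_mul]
    split_ifs
    · exact (hφd i (a i) _ (he i s)).le
    · simp
  choose f hf using fun s => cauchySeq_tendsto_of_complete (hcauchy s)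
  refine ⟨n, f, fun i => hφ i _, ?_, fun i s hs => ?_⟩
  · refine measurable_of_tendsto_metrizable (f := fun i s => T^[e i s] x) (fun i => ?_)
      (tendsto_pi_nhds.2 hf)
    have hme : Measurable (e i) := Finset.measurable_sum _ fun j _ =>
      (measurable_of_finite fun b : Bool => if b then n j else 0).comp (measurable_pi_apply j)
    exact (measurable_from_nat (f := fun m => T^[m] x)).comp hme
  · have hev : ∀ᶠ j in atTop, (T ^ (n i : ℤ)) (T^[e j s] x) = T^[e j (flipAt i s)] x := by
      filter_upwards [eventually_gt_atTop i] with j hj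
      have hij : i ∈ Finset.range j := Finset.mem_range.2 hj
      have hsum : e j (flipAt i s) = n i + e j s := by
        simp only [e]
        rw [← Finset.add_sum_erase _ _ hij, ← Finset.add_sum_erase _ _ hij]
        simp only [flipAt_self, hs, Bool.not_false, if_true, Bool.false_eq_true, if_false, zero_add]
        congr 1
        refine Finset.sum_congr rfl fun k hk => ?_
        rw [flipAt_of_ne (Finset.ne_of_mem_erase hk)]
      rw [hsum, Function.iterate_add_apply, Homeomorph.zpow_natCast_apply]
    exact tendsto_nhds_unique (hf (flipAt i s))
      ((((T ^ (n i : ℤ)).continuous.tendsto _).comp (hf s)).congr' hev)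

lemma coinTosses_fiber_eq_zero [T1Space X] [MeasurableSpace X] [BorelSpace X] {T : X ≃ₜ X}
    (hap : ∀ x : X, ∀ n : ℕ, 0 < n → T^[n] x ≠ x) {n : ℕ → ℕ} {f : (ℕ → Bool) → X}
    (hn : ∀ i, i ≤ n i) (hf : Measurable f)
    (hflip : ∀ i s, s i = false → f (flipAt i s) = (T ^ (n i : ℤ)) (f s)) (y : X) :
    coinTosses (f ⁻¹' {y}) = 0 := by
  let p : ℤ → ℝ≥0∞ := fun k => coinTosses (f ⁻¹' {(T ^ k) y})
  have hm : ∀ z : X, MeasurableSet (f ⁻¹' {z}) := fun z => hf (measurableSet_singleton z)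
  have hsum : ∑' k, p k ≠ ∞ := by
    rw [← measure_iUnion _ fun k => hm _]
    · exact measure_ne_top _ _
    · intro j k hjk
      refine Disjoint.preimage _ (disjoint_singleton.2 fun h => hjk ?_)
      exact zpow_apply_injective hap y h
  have hlim := ENNReal.tendsto_cofinite_zero_of_tsum_ne_top hsum
  have hle : ∀ i, p 0 ≤ p (n i) + p (-n i) := by
    intro i
    have hflipm : ∀ z, coinTosses (flipAt i ⁻¹' (f ⁻¹' {z})) = coinTosses (f ⁻¹' {z}) :=
      fun z => (measurePreserving_flipAt i).measure_preimage (hm z).nullMeasurableSet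
    simp only [p]
    rw [← hflipm ((T ^ (n i : ℤ)) y), ← hflipm ((T ^ (-n i : ℤ)) y)]
    refine (measure_mono fun s hs => ?_).trans (measure_union_le _ _)
    have hs' : f s = y := hs
    cases hsi : s i with
    | false =>
      left
      simp only [mem_preimage, mem_singleton_iff]
      rw [hflip i s hsi, hs']
    | true =>
      right
      have := hflip i (flipAt i s) (by simp [hsi])
      rw [flipAt_flipAt, hs'] at this
      simp only [mem_preimage, mem_singleton_iff]
      rw [this, ← Homeomorph.zpow_add_apply]
      simp
  have hntop : Tendsto n atTop atTop := tendsto_atTop_mono hn tendsto_id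
  have hinj : Function.Injective ((↑) : ℕ → ℤ) := Nat.cast_injective
  have h1 : Tendsto (fun i => p (n i)) atTop (𝓝 0) :=
    hlim.comp ((Nat.cofinite_eq_atTop ▸ hinj.tendsto_cofinite).comp hntop)
  have h2 : Tendsto (fun i => p (-n i)) atTop (𝓝 0) :=
    hlim.comp ((Nat.cofinite_eq_atTop ▸ (neg_injective.comp hinj).tendsto_cofinite).comp hntop)
  have h3 : p 0 ≤ 0 := ge_of_tendsto' (by simpa using h1.add h2) hle
  exact nonpos_iff_eq_zero.1 h3

lemma ForwardRecurrent.exists_ergodic_measure [PolishSpace X] [MeasurableSpace X] [BorelSpace X]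
    {T : X ≃ₜ X} (hap : ∀ x : X, ∀ n : ℕ, 0 < n → T^[n] x ≠ x) {x : X}
    (h : ForwardRecurrent T x) :
    ∃ μ : Measure X, IsProbabilityMeasure μ ∧ (∀ x : X, μ {x} = 0) ∧
      QuasiInvariant' μ T ∧ Ergodic' μ T := by
  obtain ⟨n, f, hn, hf, hflip⟩ := h.exists_coding
  have hTm : ∀ k : ℤ, Measurable (T ^ k) := fun k => (T ^ k).continuous.measurable
  let ρ : Measure X := coinTosses.map f
  have : IsProbabilityMeasure ρ := Measure.isProbabilityMeasure_map hf.aemeasurable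
  let m : Measure X := Measure.sum fun k : ℤ => ρ.map (T ^ k)
  have hm0 : ∀ A, MeasurableSet A → (m A = 0 ↔ ∀ k : ℤ, ρ ((T ^ k) ⁻¹' A) = 0) := by
    intro A hA
    simp only [m, Measure.sum_apply _ hA, ENNReal.tsum_eq_zero, Measure.map_apply (hTm _) hA]
  have : NeZero m := ⟨fun h0 => by simpa [h0] using (hm0 univ .univ).1⟩
  have hμ0 : ∀ A, MeasurableSet A → (m.toFinite A = 0 ↔ ∀ k : ℤ, ρ ((T ^ k) ⁻¹' A) = 0) :=
    fun A hA => toFinite_apply_eq_zero_iff.trans (hm0 A hA)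
  refine ⟨m.toFinite, inferInstance, fun y => ?_, fun N hN => ?_, fun A hA hAT => ?_⟩
  · refine (hμ0 _ (measurableSet_singleton y)).2 fun k => ?_
    have hpre : (T ^ k) ⁻¹' {y} = {(T ^ k).symm y} := by
      ext z
      exact (T ^ k).toEquiv.eq_symm_apply.symm
    rw [hpre, Measure.map_apply hf (measurableSet_singleton _)]
    exact coinTosses_fiber_eq_zero hap hn hf hflip _
  · rw [hμ0 _ hN, hμ0 _ (T.continuous.measurable hN)]
    have hshift : ∀ k : ℤ, (T ^ k) ⁻¹' (T ⁻¹' N) = (T ^ (1 + k)) ⁻¹' N := fun k => by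
      ext z
      simp only [mem_preimage, Homeomorph.zpow_add_apply, zpow_one]
    simp only [hshift]
    exact ⟨fun hk k => by simpa using hk (-1 + k), fun hk k => hk _⟩
  · have hinv : ∀ B : Set X, T ⁻¹' B = B → ∀ k : ℤ, (T ^ k) ⁻¹' B = B := fun B hB k =>
      Set.ext fun z => zpow_mem_iff_of_preimage_eq hB k z
    have hAc : T ⁻¹' Aᶜ = Aᶜ := by rw [preimage_compl, hAT]
    have hflipA : ∀ i s, flipAt i s ∈ f ⁻¹' A ↔ s ∈ f ⁻¹' A := by
      intro i s
      simp only [mem_preimage]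
      cases hsi : s i with
      | false => rw [hflip i s hsi, zpow_mem_iff_of_preimage_eq hAT]
      | true =>
        have := hflip i (flipAt i s) (by simp [hsi])
        rw [flipAt_flipAt] at this
        rw [this, zpow_mem_iff_of_preimage_eq hAT]
    rw [hμ0 _ hA, hμ0 _ hA.compl]
    simp only [hinv A hAT, hinv _ hAc, forall_const]
    rw [prob_compl_eq_zero_iff hA, Measure.map_apply hf hA]
    exact coinTosses_eq_zero_or_one (hf hA) hflipA

end ErgodicMeasure

/-- **Glimm–Effros theorem** (for `ℤ`-actions). For an aperiodic homeomorphism `T` of a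
Polish space `X` the following are equivalent:
(i) `T` has a recurrent point;
(ii) some `T`-orbit is not locally closed;
(iii) there is no Borel set meeting each `T`-orbit exactly once;
(iv) there is a non-atomic quasi-invariant Borel probability measure with respect to
which `T` is ergodic. -/
theorem stmt_11 {X : Type*} [TopologicalSpace X] [PolishSpace X]
    [MeasurableSpace X] [BorelSpace X]
    (T : X ≃ₜ X) (hap : ∀ x : X, ∀ n : ℕ, 0 < n → (⇑T)^[n] x ≠ x) :
    List.TFAE
      [ ∃ x : X, ∃ n : ℕ → ℕ, StrictMono n ∧
          Tendsto (fun i => (⇑T)^[n i] x) atTop (𝓝 x),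
        ∃ x : X, ¬ IsLocallyClosed (orbit T x),
        ¬ ∃ B : Set X, MeasurableSet B ∧ ∀ x : X, ∃! y : X, y ∈ B ∩ orbit T x,
        ∃ μ : Measure X, IsProbabilityMeasure μ ∧ (∀ x : X, μ {x} = 0) ∧
          QuasiInvariant' μ ⇑T ∧ Ergodic' μ ⇑T ] := by
  tfae_have 1 → 2 := fun ⟨x, hx⟩ => ⟨x, ForwardRecurrent.not_isLocallyClosed hap hx⟩
  tfae_have 2 → 1 := fun ⟨_, hx⟩ =>
    (TwoSidedRecurrent.of_not_isLocallyClosed hx).exists_forwardRecurrent hap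
  tfae_have 3 → 1 := fun hB => by
    by_contra hrec
    exact hB (exists_borel_transversal fun x hx => hrec (hx.exists_forwardRecurrent hap))
  tfae_have 1 → 4 := fun ⟨_, hx⟩ => ForwardRecurrent.exists_ergodic_measure hap hx
  tfae_have 4 → 3 := fun ⟨_, _, hatom, _, herg⟩ =>
    not_exists_borel_transversal_of_ergodic hatom herg
  tfae_finish
end

section
/- (Hajian–Kakutani dichotomy) Let T be an ergodic conservative measure-preserving transformation of a standard σ-finite infinite measure space (X, ℬ, μ). Then exactly one of the following holds: either T is of zero type, i.e. lim_{n→∞} μ(T⁻ⁿA ∩ A) = 0 for every set A of finite measure, or T is of positive type, i.e. limsup_{n→∞} μ(T⁻ⁿA ∩ A) > 0 for every set A of finite positive measure. -/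
open MeasureTheory Set Filter ENNReal

/-- `T` is *conservative* w.r.t. `μ`. -/
def Conservative' {X : Type*} [MeasurableSpace X] (μ : Measure X) (T : X → X) : Prop :=
  ∀ A : Set X, MeasurableSet A → 0 < μ A → ∃ n : ℕ, 0 < n ∧ 0 < μ (A ∩ T^[n] ⁻¹' A)

namespace HajianKakutani

variable {X : Type*} [MeasurableSpace X] {μ : Measure X} {T : X → X}

theorem ae_exists_iterate_mem (hT : MeasurePreserving T μ μ) (hcons : Conservative' μ T)
    (herg : Ergodic' μ T) {A : Set X} (hA : MeasurableSet A) (hpos : 0 < μ A) :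
    ∀ᵐ x ∂μ, ∃ n : ℕ, T^[n] x ∈ A := by
  have hc : Conservative T μ :=
    { hT.quasiMeasurePreserving with
      exists_mem_iterate_mem' := by
        intro s hs h0
        obtain ⟨n, hn, hμ⟩ := hcons s hs (pos_iff_ne_zero.mpr h0)
        obtain ⟨x, hx, hxn⟩ := nonempty_of_measure_ne_zero hμ.ne'
        exact ⟨x, hx, n, hn.ne', hxn⟩ }
  set W : Set X := {x | ∃ᶠ n in atTop, T^[n] x ∈ A} with hW
  have hWm : MeasurableSet W := by
    have : W = limsup (fun n => T^[n] ⁻¹' A) atTop := by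
      ext x
      simp [hW, mem_limsup_iff_frequently_mem]
    rw [this]
    exact .measurableSet_limsup fun n => (hT.iterate n).measurable hA
  have hinv : T ⁻¹' W = W := by
    ext x
    simp only [hW, mem_preimage, mem_ofPred_eq, ← Function.iterate_succ_apply]
    conv_rhs => rw [← map_add_atTop_eq_nat 1, frequently_map]
  have hAW : μ A ≤ μ W := measure_mono_ae (hc.ae_mem_imp_frequently_image_mem hA.nullMeasurableSet)
  rcases herg W hWm hinv with h | h
  · exact absurd (hAW.trans h.le) (not_le.mpr hpos)
  · have : ∀ᵐ x ∂μ, x ∈ W := h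
    filter_upwards [this] with x hx using hx.exists

theorem tendsto_measure_preimage_inter_preimage (hT : MeasurePreserving T μ μ) {A : Set X}
    (hA : MeasurableSet A)
    (h : Tendsto (fun n : ℕ => μ (T^[n] ⁻¹' A ∩ A)) atTop (nhds 0)) (i j : ℕ) :
    Tendsto (fun n : ℕ => μ (T^[n] ⁻¹' (T^[i] ⁻¹' A) ∩ T^[j] ⁻¹' A)) atTop (nhds 0) := by
  have hs : Tendsto (fun n : ℕ => n + i - j) atTop atTop :=
    (tendsto_sub_atTop_nat j).comp (tendsto_add_atTop_nat i)
  refine (h.comp hs).congr' ?_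
  filter_upwards [eventually_ge_atTop j] with n hn
  have hm : MeasurableSet (T^[n + i - j] ⁻¹' A ∩ A) :=
    ((hT.iterate _).measurable hA).inter hA
  rw [Function.comp_apply, ← (hT.iterate j).measure_preimage hm.nullMeasurableSet,
    preimage_inter, ← preimage_comp, ← preimage_comp, ← Function.iterate_add,
    ← Function.iterate_add, Nat.sub_add_cancel (by lia), add_comm i n]

theorem tendsto_measure_biUnion (hT : MeasurePreserving T μ μ) {A : Set X}
    (hA : MeasurableSet A)
    (h : Tendsto (fun n : ℕ => μ (T^[n] ⁻¹' A ∩ A)) atTop (nhds 0)) (N : ℕ) :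
    Tendsto (fun n : ℕ => μ (T^[n] ⁻¹' (⋃ i ∈ Finset.range N, T^[i] ⁻¹' A) ∩
      ⋃ j ∈ Finset.range N, T^[j] ⁻¹' A)) atTop (nhds 0) := by
  have hsum : Tendsto (fun n : ℕ => ∑ i ∈ Finset.range N, ∑ j ∈ Finset.range N,
      μ (T^[n] ⁻¹' (T^[i] ⁻¹' A) ∩ T^[j] ⁻¹' A)) atTop (nhds 0) := by
    simpa using tendsto_finsetSum (Finset.range N) fun i _ =>
      tendsto_finsetSum (Finset.range N) fun j _ =>
        tendsto_measure_preimage_inter_preimage hT hA h i j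
  refine tendsto_of_tendsto_of_tendsto_of_le_of_le tendsto_const_nhds hsum
    (fun _ => zero_le) fun n => ?_
  simp only [preimage_iUnion, iUnion_inter]
  refine (measure_biUnion_finset_le _ _).trans (Finset.sum_le_sum fun i _ => ?_)
  simp only [inter_iUnion]
  exact measure_biUnion_finset_le _ _

theorem tendsto_measure_diff_biUnion (hT : Measurable T) {A B : Set X} (hA : MeasurableSet A)
    (hB : MeasurableSet B) (hfin : μ B ≠ ∞) (hret : ∀ᵐ x ∂μ, ∃ n : ℕ, T^[n] x ∈ A) :
    Tendsto (fun N : ℕ => μ (B \ ⋃ i ∈ Finset.range N, T^[i] ⁻¹' A)) atTop (nhds 0) := by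
  have hm (N : ℕ) : MeasurableSet (B \ ⋃ i ∈ Finset.range N, T^[i] ⁻¹' A) :=
    hB.diff (Finset.measurableSet_biUnion _ fun i _ => hT.iterate i hA)
  have hanti : Antitone fun N : ℕ => B \ ⋃ i ∈ Finset.range N, T^[i] ⁻¹' A :=
    fun M N hMN => sdiff_subset_sdiff_right
      (biUnion_subset_biUnion_left fun i hi => Finset.range_mono hMN hi)
  have hzero : μ (⋂ N : ℕ, B \ ⋃ i ∈ Finset.range N, T^[i] ⁻¹' A) = 0 := by
    refine measure_mono_null (fun x hx => ?_) hret
    rintro ⟨n, hn⟩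
    exact (mem_iInter.mp hx (n + 1)).2 (mem_biUnion (Finset.self_mem_range_succ n) hn)
  rw [← hzero]
  exact tendsto_measure_iInter_atTop (fun N => (hm N).nullMeasurableSet) hanti
    ⟨0, measure_ne_top_of_subset sdiff_subset hfin⟩

/-- If one set of positive measure has vanishing self-correlations along an ergodic conservative
transformation, then so has every set of finite measure. -/
theorem tendsto_measure_preimage_inter_self (hT : MeasurePreserving T μ μ)
    (hcons : Conservative' μ T) (herg : Ergodic' μ T) {A B : Set X} (hA : MeasurableSet A)
    (hpos : 0 < μ A) (h : Tendsto (fun n : ℕ => μ (T^[n] ⁻¹' A ∩ A)) atTop (nhds 0))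
    (hB : MeasurableSet B) (hfin : μ B ≠ ∞) :
    Tendsto (fun n : ℕ => μ (T^[n] ⁻¹' B ∩ B)) atTop (nhds 0) := by
  have hdiff := tendsto_measure_diff_biUnion hT.measurable hA hB hfin
    (ae_exists_iterate_mem hT hcons herg hA hpos)
  rw [ENNReal.tendsto_nhds_zero]
  intro ε hε
  have hε3 : 0 < ε / 3 := ENNReal.div_pos hε.ne' (by simp)
  obtain ⟨N, hN⟩ := (ENNReal.tendsto_nhds_zero.mp hdiff (ε / 3) hε3).exists
  filter_upwards [ENNReal.tendsto_nhds_zero.mp (tendsto_measure_biUnion hT hA h N) (ε / 3) hε3]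
    with n hn
  set U : Set X := ⋃ i ∈ Finset.range N, T^[i] ⁻¹' A with hU
  have hUm : MeasurableSet U :=
    Finset.measurableSet_biUnion _ fun i _ => (hT.iterate i).measurable hA
  have hsub : T^[n] ⁻¹' B ∩ B ⊆ (T^[n] ⁻¹' U ∩ U) ∪ (T^[n] ⁻¹' (B \ U) ∪ B \ U) := by
    rintro x ⟨hx, hx'⟩
    by_cases h1 : x ∈ U
    · by_cases h2 : T^[n] x ∈ U
      · exact .inl ⟨h2, h1⟩
      · exact .inr (.inl ⟨hx, h2⟩)
    · exact .inr (.inr ⟨hx', h1⟩)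
  calc μ (T^[n] ⁻¹' B ∩ B)
      ≤ μ (T^[n] ⁻¹' U ∩ U) + (μ (T^[n] ⁻¹' (B \ U)) + μ (B \ U)) :=
        (measure_mono hsub).trans ((measure_union_le _ _).trans
          (add_le_add_right (measure_union_le _ _) _))
    _ ≤ ε / 3 + (ε / 3 + ε / 3) := by
        rw [(hT.iterate n).measure_preimage (hB.diff hUm).nullMeasurableSet]
        gcongr
    _ = ε := by rw [← add_assoc, ENNReal.add_thirds]

end HajianKakutani

/-- **Hajian–Kakutani dichotomy.** An ergodic conservative measure-preserving
transformation `T` of a standard σ-finite infinite measure space is either of *zero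
type*, i.e. `μ(T⁻ⁿA ∩ A) → 0` for every set `A` of finite measure, or of *positive
type*, i.e. `limsup_n μ(T⁻ⁿA ∩ A) > 0` for every set `A` of finite positive measure —
and exactly one of the two alternatives holds. -/
theorem stmt_12 {X : Type*} [MeasurableSpace X] [StandardBorelSpace X]
    (μ : Measure X) [SigmaFinite μ] (hinf : μ univ = ∞) (T : X ≃ᵐ X)
    (hmp : ∀ A : Set X, MeasurableSet A → μ (⇑T ⁻¹' A) = μ A)
    (hcons : Conservative' μ ⇑T) (herg : Ergodic' μ ⇑T) :
    Xor'
      (∀ A : Set X, MeasurableSet A → μ A ≠ ∞ →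
        Tendsto (fun n : ℕ => μ ((⇑T)^[n] ⁻¹' A ∩ A)) atTop (nhds 0))
      (∀ A : Set X, MeasurableSet A → μ A ≠ ∞ → 0 < μ A →
        0 < Filter.limsup (fun n : ℕ => μ ((⇑T)^[n] ⁻¹' A ∩ A)) atTop) := by
  have hT : MeasurePreserving T μ μ :=
    ⟨T.measurable, Measure.ext fun A hA => by rw [Measure.map_apply T.measurable hA, hmp A hA]⟩
  by_cases hzero : ∀ A : Set X, MeasurableSet A → μ A ≠ ∞ →
      Tendsto (fun n : ℕ => μ ((⇑T)^[n] ⁻¹' A ∩ A)) atTop (nhds 0)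
  · refine .inl ⟨hzero, fun hlim => ?_⟩
    obtain ⟨A, hA, -, hpos, hfin⟩ :=
      Measure.exists_subset_measure_lt_top (μ := μ) MeasurableSet.univ (r := 0) (by simp [hinf])
    exact (hlim A hA hfin.ne hpos).ne' (hzero A hA hfin.ne).limsup_eq
  · refine .inr ⟨fun A hA _ hpos => ?_, hzero⟩
    by_contra hlim
    exact hzero fun B hB hBfin =>
      HajianKakutani.tendsto_measure_preimage_inter_self hT hcons herg hA hpos
        (tendsto_of_le_liminf_of_limsup_le zero_le (not_lt.mp hlim)) hB hBfin
end

section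
/- (Aaronson–Nakada) Let (X, ℬ, μ, T) be a conservative aperiodic nonsingular dynamical system and let p be a positive integer. Then X = C_p ∪ D_p, where C_p and D_p are disjoint T-invariant measurable subsets, D_p is a countable union of p-wandering sets, the restriction of T to C_p is p-recurrent, and Σ_{k=1}^∞ μ(B ∩ T⁻ᵏB ∩ T⁻²ᵏB ∩ ⋯ ∩ T⁻ᵖᵏB) = ∞ for every measurable B ⊆ C_p of positive measure. -/
open MeasureTheory Set Filter ENNReal

/-- `A` is *p-wandering*: `μ(A ∩ TᵏA ∩ T²ᵏA ∩ ⋯ ∩ TᵖᵏA) = 0` for every `k ≥ 1`. -/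
def PWandering {X : Type*} [MeasurableSpace X] (μ : Measure X) (T : X → X) (p : ℕ)
    (A : Set X) : Prop :=
  ∀ k : ℕ, 0 < k → μ (⋂ j ∈ Finset.range (p + 1), T^[j * k] '' A) = 0

/-- A measurable exhaustion principle: for any property `P` of sets, there is a countable family of
measurable sets with property `P` whose union meets every measurable set with property `P`
disjoint from it in a null set. -/
theorem exists_seq_iUnion_maximal {X : Type*} [MeasurableSpace X] (μ : Measure X) [SFinite μ]
    (P : Set X → Prop) (hP : P ∅) :
    ∃ W : ℕ → Set X, (∀ n, MeasurableSet (W n) ∧ P (W n)) ∧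
      ∀ B, MeasurableSet B → P B → Disjoint B (⋃ n, W n) → μ B = 0 := by
  let F : Set (ℕ → Set X) := {W | ∀ n, MeasurableSet (W n) ∧ P (W n)}
  let m : (ℕ → Set X) → ℝ≥0∞ := fun W => μ.toFinite (⋃ n, W n)
  have hF : (m '' F).Nonempty := ⟨_, fun _ => ∅, fun _ => ⟨.empty, hP⟩, rfl⟩
  obtain ⟨u, -, hu, huF⟩ := exists_seq_tendsto_sSup hF (OrderTop.bddAbove _)
  choose W hWF hWu using huF
  let V : ℕ → Set X := fun i => W i.unpair.1 i.unpair.2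
  have hV : ⋃ i, V i = ⋃ i, ⋃ j, W i j := iSup_unpair fun i j => W i j
  have hVmax : sSup (m '' F) ≤ m V := by
    refine le_of_tendsto' hu fun i => ?_
    rw [← hWu]
    refine measure_mono ?_
    rw [hV]
    exact subset_iUnion (fun i => ⋃ j, W i j) i
  refine ⟨V, fun i => hWF _ _, fun B hB hPB hd => ?_⟩
  let V' : ℕ → Set X := fun n => Nat.casesOn n B V
  have hV'F : V' ∈ F := by
    rintro (_ | n)
    exacts [⟨hB, hPB⟩, hWF _ _]
  have hV' : ⋃ i, V' i = B ∪ ⋃ i, V i := by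
    ext x
    simp only [mem_iUnion, mem_union]
    refine ⟨?_, ?_⟩
    · rintro ⟨_ | n, h⟩
      exacts [.inl h, .inr ⟨n, h⟩]
    · rintro (h | ⟨n, h⟩)
      exacts [⟨0, h⟩, ⟨n + 1, h⟩]
  have hle : m V' ≤ m V := (le_sSup (mem_image_of_mem m hV'F)).trans hVmax
  have hVm : MeasurableSet (⋃ i, V i) := .iUnion fun i => (hWF _ _).1
  simp only [m, hV'] at hle
  rw [measure_union hd hVm] at hle
  refine absolutelyContinuous_toFinite μ ?_
  have h0 : μ.toFinite B + μ.toFinite (⋃ i, V i) ≤ 0 + μ.toFinite (⋃ i, V i) := by simpa using hle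
  exact nonpos_iff_eq_zero.1 ((ENNReal.add_le_add_iff_right (measure_ne_top _ _)).1 h0)

/-- A set of positive measure on which `f` moves almost every point contains a set of positive
measure disjoint from its preimage under `f`. -/
theorem exists_subset_disjoint_preimage {X : Type*} [MeasurableSpace X]
    [MeasurableSpace.CountablySeparated X] (μ : Measure X) {f : X → X} (hf : Measurable f)
    (hfix : ∀ᵐ x ∂μ, f x ≠ x) {B : Set X} (hB : MeasurableSet B) (hμ : 0 < μ B) :
    ∃ A ⊆ B, MeasurableSet A ∧ 0 < μ A ∧ A ∩ f ⁻¹' A = ∅ := by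
  obtain ⟨g, hg, hinj⟩ := MeasurableSpace.measurable_injection_nat_bool_of_countablySeparated X
  let U : ℕ × Bool → Set X := fun i => {x | g x i.1 = i.2}
  have hU : ∀ i, MeasurableSet (U i) := fun i =>
    measurableSet_eq_fun ((measurable_pi_apply i.1).comp hg) measurable_const
  by_contra! hno
  have hnull : ∀ i, μ (B ∩ (U i ∩ f ⁻¹' (U i)ᶜ)) = 0 := by
    intro i
    by_contra hpos
    refine (hno _ inter_subset_left (hB.inter ((hU i).inter (hf (hU i).compl)))
      (pos_iff_ne_zero.2 hpos)).ne_empty ?_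
    ext x
    simp only [mem_inter_iff, mem_preimage, mem_compl_iff, mem_empty_iff_false]
    tauto
  refine hμ.ne' (measure_mono_null ?_ (measure_union_null (measure_iUnion_null hnull) hfix))
  intro x hx
  by_cases h : f x = x
  · exact .inr (by simpa using h)
  · obtain ⟨n, hn⟩ := Function.ne_iff.1 (hinj.ne h)
    exact .inl (mem_iUnion.2 ⟨(n, g x n), hx, rfl, hn⟩)

/-- In an aperiodic system every set of positive measure contains a set of positive measure
disjoint from its first `N` preimages. -/
theorem exists_subset_disjoint_iterate_preimage {X : Type*} [MeasurableSpace X]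
    [MeasurableSpace.CountablySeparated X] (μ : Measure X) {f : X → X} (hf : Measurable f)
    (hap : ∀ᵐ x ∂μ, ∀ n : ℕ, 0 < n → f^[n] x ≠ x) {B : Set X} (hB : MeasurableSet B)
    (hμ : 0 < μ B) (N : ℕ) :
    ∃ A ⊆ B, MeasurableSet A ∧ 0 < μ A ∧ ∀ k, 0 < k → k ≤ N → A ∩ f^[k] ⁻¹' A = ∅ := by
  induction N with
  | zero => exact ⟨B, Subset.rfl, hB, hμ, fun k hk hk' => by omega⟩
  | succ N ih =>
    obtain ⟨A, hAB, hA, hpos, hdis⟩ := ih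
    obtain ⟨A', hAA, hA', hpos', hdis'⟩ := exists_subset_disjoint_preimage μ (hf.iterate (N + 1))
      (hap.mono fun x hx => hx _ N.succ_pos) hA hpos
    refine ⟨A', hAA.trans hAB, hA', hpos', fun k hk hkN => ?_⟩
    rcases hkN.eq_or_lt with rfl | hlt
    · exact hdis'
    · exact subset_empty_iff.1 ((inter_subset_inter hAA (preimage_mono hAA)).trans
        (hdis k hk (by omega)).subset)

/-- The set of points whose orbit along the progression `0, k, …, pk` stays in `B`. -/
def progressionReturn {X : Type*} (T : X → X) (p k : ℕ) (B : Set X) : Set X :=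
  ⋂ j ∈ Finset.range (p + 1), T^[j * k] ⁻¹' B

theorem mem_progressionReturn {X : Type*} {T : X → X} {p k : ℕ} {B : Set X} {x : X} :
    x ∈ progressionReturn T p k B ↔ ∀ j ≤ p, T^[j * k] x ∈ B := by
  simp [progressionReturn]

theorem progressionReturn_subset {X : Type*} (T : X → X) (p k : ℕ) (B : Set X) :
    progressionReturn T p k B ⊆ B := fun x hx => by
  simpa using mem_progressionReturn.1 hx 0 p.zero_le

theorem progressionReturn_mono {X : Type*} (T : X → X) (p k : ℕ) {A B : Set X} (h : A ⊆ B) :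
    progressionReturn T p k A ⊆ progressionReturn T p k B := fun _ hx =>
  mem_progressionReturn.2 fun j hj => h (mem_progressionReturn.1 hx j hj)

theorem measurableSet_progressionReturn {X : Type*} [MeasurableSpace X] {T : X → X}
    (hT : Measurable T) (p k : ℕ) {B : Set X} (hB : MeasurableSet B) :
    MeasurableSet (progressionReturn T p k B) :=
  Finset.measurableSet_biInter _ fun _ _ => hT.iterate _ hB

theorem progressionReturn_preimage {X : Type*} {T S : X → X} (h : Function.Commute T S) (p k : ℕ)
    (B : Set X) :
    progressionReturn T p k (S ⁻¹' B) = S ⁻¹' progressionReturn T p k B := by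
  ext x
  simp only [mem_progressionReturn, mem_preimage, (h.iterate_left _).eq]

/-- For an invertible nonsingular map, `p`-wandering sets can be described through preimages. -/
theorem pWandering_iff {X : Type*} [MeasurableSpace X] {μ : Measure X} {T : X ≃ᵐ X}
    (hns : ∀ N : Set X, MeasurableSet N → (μ (⇑T ⁻¹' N) = 0 ↔ μ N = 0)) {p : ℕ} {A : Set X}
    (hA : MeasurableSet A) :
    PWandering μ T p A ↔ ∀ k, 0 < k → μ (progressionReturn T p k A) = 0 := by
  have hiter : ∀ n, ∀ N : Set X, MeasurableSet N → (μ ((⇑T)^[n] ⁻¹' N) = 0 ↔ μ N = 0) := by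
    intro n
    induction n with
    | zero => simp
    | succ n ih =>
      intro N hN
      rw [Function.iterate_succ', preimage_comp, ih _ (T.measurable hN), hns N hN]
  have himage : ∀ n, MeasurableSet ((⇑T)^[n] '' A) := by
    intro n
    induction n with
    | zero => simpa
    | succ n ih =>
      rw [Function.iterate_succ', image_comp]
      exact T.measurableSet_image.2 ih
  refine forall₂_congr fun k _ => ?_
  rw [← hiter (p * k) _ (Finset.measurableSet_biInter _ fun j _ => himage _)]
  suffices h : (⇑T)^[p * k] ⁻¹' (⋂ j ∈ Finset.range (p + 1), (⇑T)^[j * k] '' A) =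
      progressionReturn T p k A by rw [h]
  have hmem : ∀ x i j, i + j = p → ((⇑T)^[p * k] x ∈ (⇑T)^[j * k] '' A ↔ (⇑T)^[i * k] x ∈ A) := by
    rintro x i j rfl
    rw [add_comm, add_mul, Function.iterate_add_apply]
    exact (T.injective.iterate _).mem_set_image
  ext x
  simp only [mem_preimage, mem_iInter, Finset.mem_range, Nat.lt_succ_iff, mem_progressionReturn]
  refine ⟨fun h j hj => (hmem x j (p - j) (by omega)).1 (h _ (by omega)),
    fun h j hj => (hmem x (p - j) j (by omega)).2 (h _ (by omega))⟩

/-- If the measures of the return sets of `B` are summable, then `B` contains a `p`-wandering set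
of positive measure. -/
theorem exists_subset_progressionReturn_null {X : Type*} [MeasurableSpace X]
    [MeasurableSpace.CountablySeparated X] (μ : Measure X) {T : X → X} (hT : Measurable T)
    (hap : ∀ᵐ x ∂μ, ∀ n : ℕ, 0 < n → T^[n] x ≠ x) {p : ℕ} (hp : 0 < p) {B : Set X}
    (hB : MeasurableSet B) (hμ : 0 < μ B)
    (hsum : ∑' k : ℕ, μ (progressionReturn T p (k + 1) B) ≠ ∞) :
    ∃ A ⊆ B, MeasurableSet A ∧ 0 < μ A ∧ ∀ k, 0 < k → μ (progressionReturn T p k A) = 0 := by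
  let E : ℕ → Set X := fun k => progressionReturn T p (k + 1) B
  have hE : ∀ k, MeasurableSet (E k) := fun k => measurableSet_progressionReturn hT _ _ hB
  have hfin : ∀ᵐ x ∂μ, ∀ᶠ k in atTop, x ∉ E k := ae_eventually_notMem hsum
  let G : ℕ → Set X := fun N => B ∩ ⋂ k, ⋂ (_ : N ≤ k), (E k)ᶜ
  have hG : ∀ N, MeasurableSet (G N) := fun N =>
    hB.inter (.iInter fun k => .iInter fun _ => (hE k).compl)
  obtain ⟨N, hN⟩ : ∃ N, 0 < μ (G N) := by
    by_contra! hno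
    refine hμ.ne' (measure_mono_null (t := (⋃ N, G N) ∪ {x | ¬ ∀ᶠ k in atTop, x ∉ E k})
      (fun x hx => ?_)
      (measure_union_null (measure_iUnion_null fun N => nonpos_iff_eq_zero.1 (hno N)) hfin))
    by_cases h : ∀ᶠ k in atTop, x ∉ E k
    · obtain ⟨N, hN⟩ := eventually_atTop.1 h
      exact .inl (mem_iUnion.2 ⟨N, hx, mem_iInter₂.2 hN⟩)
    · exact .inr h
  obtain ⟨A, hAG, hA, hpos, hdis⟩ :=
    exists_subset_disjoint_iterate_preimage μ hT hap (hG N) hN N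
  refine ⟨A, hAG.trans inter_subset_left, hA, hpos, fun k hk => ?_⟩
  suffices h : progressionReturn T p k A = ∅ by rw [h, measure_empty]
  refine eq_empty_of_forall_notMem fun x hx => ?_
  have hxA := progressionReturn_subset _ _ _ _ hx
  rcases le_or_gt k N with hkN | hkN
  · refine (hdis k hk hkN).subset ⟨hxA, ?_⟩
    simpa using mem_progressionReturn.1 hx 1 hp
  · obtain ⟨k, rfl⟩ := Nat.exists_eq_succ_of_ne_zero hk.ne'
    exact mem_iInter₂.1 (hAG hxA).2 k (by omega)
      (progressionReturn_mono T p _ (hAG.trans inter_subset_left) hx)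

/-- **Aaronson–Nakada `p`-analogue of the Hopf decomposition.** If `(X, ℬ, μ, T)` is a
conservative aperiodic nonsingular dynamical system and `p ∈ ℕ`, `p ≥ 1`, then
`X = C_p ∪ D_p` where `C_p`, `D_p` are disjoint `T`-invariant sets, `D_p` is a countable
union of `p`-wandering sets, `T` restricted to `C_p` is `p`-recurrent, and
`Σ_{k ≥ 1} μ(B ∩ T⁻ᵏB ∩ ⋯ ∩ T⁻ᵖᵏB) = ∞` for every `B ⊆ C_p` of positive measure. -/
theorem stmt_13 {X : Type*} [MeasurableSpace X] [StandardBorelSpace X]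
    (μ : Measure X) [SigmaFinite μ] (T : X ≃ᵐ X)
    (hns : ∀ N : Set X, MeasurableSet N → (μ (⇑T ⁻¹' N) = 0 ↔ μ N = 0))
    (hcons : Conservative' μ ⇑T)
    (hap : ∀ᵐ x ∂μ, ∀ n : ℕ, 0 < n → (⇑T)^[n] x ≠ x)
    (p : ℕ) (hp : 0 < p) :
    ∃ C D : Set X, MeasurableSet C ∧ MeasurableSet D ∧ Disjoint C D ∧ C ∪ D = univ ∧
      ⇑T ⁻¹' C = C ∧ ⇑T ⁻¹' D = D ∧
      (∃ W : ℕ → Set X, (∀ n, MeasurableSet (W n) ∧ PWandering μ (⇑T) p (W n)) ∧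
        D = ⋃ n, W n) ∧
      (∀ B : Set X, MeasurableSet B → B ⊆ C → 0 < μ B →
        ∃ k : ℕ, 0 < k ∧ 0 < μ (⋂ j ∈ Finset.range (p + 1), (⇑T)^[j * k] ⁻¹' B)) ∧
      (∀ B : Set X, MeasurableSet B → B ⊆ C → 0 < μ B →
        ∑' k : ℕ, μ (⋂ j ∈ Finset.range (p + 1), (⇑T)^[j * (k + 1)] ⁻¹' B) = ∞) := by
  let S : X → X := T.symm
  have hTS : Function.Commute (⇑T) S := fun x => by simp [S]
  have hS : Measurable S := T.symm.measurable
  have hnsS : ∀ N, MeasurableSet N → (μ (S ⁻¹' N) = 0 ↔ μ N = 0) := fun N hN => by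
    rw [← hns _ (hS hN), ← preimage_comp]
    simp [S]
  let Q : Set X → Prop := fun A => ∀ k, 0 < k → μ (progressionReturn T p k A) = 0
  have hQT : ∀ A, MeasurableSet A → Q A → Q (⇑T ⁻¹' A) := fun A hA h k hk => by
    rw [progressionReturn_preimage (Function.Commute.refl _),
      hns _ (measurableSet_progressionReturn T.measurable _ _ hA)]
    exact h k hk
  have hQS : ∀ A, MeasurableSet A → Q A → Q (S ⁻¹' A) := fun A hA h k hk => by
    rw [progressionReturn_preimage hTS,
      hnsS _ (measurableSet_progressionReturn T.measurable _ _ hA)]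
    exact h k hk
  obtain ⟨W, hW, hWmax⟩ := exists_seq_iUnion_maximal μ Q fun k _ =>
    measure_mono_null (progressionReturn_subset _ _ _ _) measure_empty
  have hback : ∀ b n, MeasurableSet (S^[b] ⁻¹' W n) ∧ Q (S^[b] ⁻¹' W n) := by
    intro b n
    induction b with
    | zero => exact hW n
    | succ b ih =>
      rw [Function.iterate_succ, preimage_comp]
      exact ⟨hS ih.1, hQS _ ih.1 ih.2⟩
  let V : ℕ × ℕ × ℕ → Set X := fun i => (⇑T)^[i.1] ⁻¹' (S^[i.2.1] ⁻¹' W i.2.2)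
  have hV : ∀ i, MeasurableSet (V i) ∧ Q (V i) := by
    rintro ⟨a, b, n⟩
    induction a with
    | zero => exact hback b n
    | succ a ih =>
      simp only [V, Function.iterate_succ, preimage_comp (g := (⇑T)^[a])]
      exact ⟨T.measurable ih.1, hQT _ ih.1 ih.2⟩
  let D : Set X := ⋃ i, V i
  have hD : MeasurableSet D := .iUnion fun i => (hV i).1
  have hTD : ⇑T ⁻¹' D ⊆ D := by
    intro x hx
    obtain ⟨⟨a, b, n⟩, h⟩ := mem_iUnion.1 hx
    exact mem_iUnion.2 ⟨(a + 1, b, n), h⟩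
  have hSD : S ⁻¹' D ⊆ D := by
    intro x hx
    obtain ⟨⟨a, b, n⟩, h⟩ := mem_iUnion.1 hx
    refine mem_iUnion.2 ⟨(a, b + 1, n), ?_⟩
    simp only [V, mem_preimage, Function.iterate_succ_apply] at h ⊢
    rwa [← (hTS.iterate_left a).eq]
  have hDinv : ⇑T ⁻¹' D = D := hTD.antisymm fun x hx => hSD (by simpa [S] using hx)
  have hWD : ⋃ n, W n ⊆ D := iUnion_subset fun n => subset_iUnion V (0, 0, n)
  have hnull : ∀ A, MeasurableSet A → A ⊆ Dᶜ → Q A → μ A = 0 := fun A hA hAD hQA =>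
    hWmax A hA hQA ((disjoint_compl_left.mono_left hAD).mono_right hWD)
  refine ⟨Dᶜ, D, hD.compl, hD, disjoint_compl_left, compl_union_self D,
    by rw [preimage_compl, hDinv], hDinv,
    ⟨fun n => V ((Denumerable.eqv (ℕ × ℕ × ℕ)).symm n), fun n => ⟨(hV _).1,
      (pWandering_iff hns (hV _).1).2 (hV _).2⟩,
      ((Denumerable.eqv (ℕ × ℕ × ℕ)).symm.surjective.iUnion_comp V).symm⟩, ?_, ?_⟩
  · intro B hB hBC hμ
    by_contra! hno
    exact hμ.ne' (hnull B hB hBC fun k hk => nonpos_iff_eq_zero.1 (hno k hk))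
  · intro B hB hBC hμ
    by_contra hsum
    obtain ⟨A, hAB, hA, hpos, hQA⟩ :=
      exists_subset_progressionReturn_null μ T.measurable hap hp hB hμ hsum
    exact hpos.ne' (hnull A hA (hAB.trans hBC) hQA)
end

section
/- (Maharam) Let T be a nonsingular transformation of a standard probability space (X, ℬ, μ), and let the Maharam extension T̃ be the transformation of X × ℝ, equipped with the σ-finite measure μ × κ where dκ(y) = e^y dy, defined by T̃(x, y) = (Tx, y − log (d(μ∘T)/dμ)(x)). Then T̃ preserves the measure μ × κ, and T̃ is conservative if and only if T is conservative. -/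
open MeasureTheory Set Filter ENNReal

/-- The measure `κ` on `ℝ` with `dκ(y) = e^y dy`. -/
noncomputable def kappa : Measure ℝ :=
  MeasureTheory.volume.withDensity fun y => ENNReal.ofReal (Real.exp y)

/-- The **Maharam extension** of `T`:
`T̃(x, y) = (Tx, y − log (d(μ∘T)/dμ)(x))` on `X × ℝ`. -/
noncomputable def maharam {X : Type*} [MeasurableSpace X] (μ : Measure X) (T : X ≃ᵐ X) :
    X × ℝ → X × ℝ :=
  fun p => (T p.1, p.2 - Real.log (((μ.map ⇑T.symm).rnDeriv μ p.1).toReal))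

namespace Maharam

section Wandering

variable {Y : Type*} [MeasurableSpace Y] {ν : Measure Y}

/-- The preimages of a wandering set are almost disjoint, so they fill at most the measure of any
given set. -/
theorem tsum_measure_iterate_preimage_inter_le {S : Y → Y} (hS : MeasurePreserving S ν ν)
    {W F : Set Y} (hW : MeasurableSet W) (hF : MeasurableSet F)
    (hwand : ∀ n, 0 < n → ν (W ∩ S^[n] ⁻¹' W) = 0) :
    ∑' n, ν (S^[n] ⁻¹' W ∩ F) ≤ ν F := by
  have hm (n : ℕ) : MeasurableSet (S^[n] ⁻¹' W) := (hS.measurable.iterate n) hW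
  have hlt {m n : ℕ} (hmn : m < n) : AEDisjoint ν (S^[m] ⁻¹' W) (S^[n] ⁻¹' W) := by
    obtain ⟨k, rfl⟩ := Nat.exists_eq_add_of_lt hmn
    have h : S^[m] ⁻¹' W ∩ S^[m + k + 1] ⁻¹' W = S^[m] ⁻¹' (W ∩ S^[k + 1] ⁻¹' W) := by
      rw [preimage_inter, ← preimage_comp, ← Function.iterate_add, add_comm (k + 1) m, add_assoc]
    rw [AEDisjoint, h, (hS.iterate m).measure_preimage (hW.inter (hm _)).nullMeasurableSet]
    exact hwand _ k.succ_pos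
  have hd : Pairwise (Function.onFun (AEDisjoint ν) fun n => S^[n] ⁻¹' W ∩ F) := by
    intro m n hmn
    refine AEDisjoint.mono ?_ inter_subset_left inter_subset_left
    rcases hmn.lt_or_gt with h | h
    · exact hlt h
    · exact (hlt h).symm
  rw [← measure_iUnion₀ hd fun n => ((hm n).inter hF).nullMeasurableSet]
  exact measure_mono (iUnion_subset fun n => inter_subset_right)

theorem measure_iterate_symm_preimage_inter {S : Y ≃ᵐ Y} (hS : MeasurePreserving S ν ν)
    {W F : Set Y} (hW : MeasurableSet W) (hF : MeasurableSet F) (n : ℕ) :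
    ν (S.symm^[n] ⁻¹' W ∩ F) = ν (W ∩ S^[n] ⁻¹' F) := by
  rw [← (hS.iterate n).measure_preimage
    (((S.symm.measurable.iterate n) hW).inter hF).nullMeasurableSet,
    preimage_inter, ← preimage_comp,
    (Function.LeftInverse.iterate S.symm_apply_apply n).comp_eq_id, preimage_id]

/-- Almost every point of a wandering set visits a set of finite measure only finitely often. -/
theorem ae_eventually_iterate_notMem {S : Y ≃ᵐ Y} (hS : MeasurePreserving S ν ν)
    {W F : Set Y} (hW : MeasurableSet W) (hF : MeasurableSet F) (hFfin : ν F ≠ ∞)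
    (hwand : ∀ n, 0 < n → ν (W ∩ S^[n] ⁻¹' W) = 0) :
    ∀ᵐ p ∂ν, p ∈ W → ∀ᶠ n in atTop, S^[n] p ∉ F := by
  have hS' : MeasurePreserving S.symm ν ν := hS.symm S
  have hwand' (n : ℕ) (hn : 0 < n) : ν (W ∩ S.symm^[n] ⁻¹' W) = 0 := by
    rw [inter_comm, measure_iterate_symm_preimage_inter hS hW hW]
    exact hwand n hn
  have hsum : ∑' n, ν (W ∩ S^[n] ⁻¹' F) ≠ ∞ := by
    simp_rw [← measure_iterate_symm_preimage_inter hS hW hF]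
    exact ne_top_of_le_ne_top hFfin (tsum_measure_iterate_preimage_inter_le hS' hW hF hwand')
  filter_upwards [ae_eventually_notMem hsum] with p hp hpW
  filter_upwards [hp] with n hn hnF
  exact hn ⟨hpW, hnF⟩

end Wandering

section Kappa

instance : SFinite kappa := by unfold kappa; infer_instance

theorem kappa_Iic_ne_top (a : ℝ) : kappa (Iic a) ≠ ∞ := by
  rw [kappa, withDensity_apply _ measurableSet_Iic]
  exact (integrableOn_exp_Iic a).lintegral_lt_top.ne

theorem kappa_univ_ne_zero : kappa univ ≠ 0 := by
  rw [kappa, withDensity_apply _ MeasurableSet.univ, Measure.restrict_univ]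
  intro h
  rw [lintegral_eq_zero_iff (by fun_prop)] at h
  have h' : ∀ᵐ _ : ℝ, False := by
    filter_upwards [h] with y hy
    exact (ENNReal.ofReal_pos.2 (Real.exp_pos y)).ne' hy
  simp [NeZero.ne] at h'

theorem kappa_preimage_sub (c : ℝ) {E : Set ℝ} (hE : MeasurableSet E) :
    kappa ((fun y => y - c) ⁻¹' E) = ENNReal.ofReal (Real.exp c) * kappa E := by
  have hm : MeasurableSet ((fun y => y - c) ⁻¹' E) := (measurable_id.sub_const c) hE
  rw [kappa, withDensity_apply _ hm, withDensity_apply _ hE, ← lintegral_indicator hm,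
    ← lintegral_indicator hE, ← lintegral_const_mul _ (by measurability),
    ← lintegral_sub_right_eq_self
      (fun y => ENNReal.ofReal (Real.exp c) * E.indicator (fun y => ENNReal.ofReal (Real.exp y)) y)
      c]
  refine lintegral_congr fun y => ?_
  by_cases hy : y - c ∈ E
  · rw [indicator_of_mem (by exact hy), indicator_of_mem hy,
      ← ENNReal.ofReal_mul (Real.exp_pos c).le, ← Real.exp_add, add_sub_cancel]
  · rw [indicator_of_notMem (by exact hy), indicator_of_notMem hy, mul_zero]

end Kappa

section SkewProduct

variable {X : Type*} [MeasurableSpace X] {μ : Measure X}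

/-- The skew product `(x, y) ↦ (T x, y - φ x)` as a measurable equivalence. -/
def skew (T : X ≃ᵐ X) (φ : X → ℝ) (hφ : Measurable φ) : X × ℝ ≃ᵐ X × ℝ where
  toFun p := (T p.1, p.2 - φ p.1)
  invFun p := (T.symm p.1, p.2 + φ (T.symm p.1))
  left_inv p := by simp
  right_inv p := by simp
  measurable_toFun := by
    simp only [Equiv.coe_fn_mk]
    fun_prop
  measurable_invFun := by
    simp only [Equiv.coe_fn_symm_mk]
    fun_prop

variable {T : X ≃ᵐ X} {φ : X → ℝ} {hφ : Measurable φ}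

theorem iterate_skew_fst (n : ℕ) (p : X × ℝ) : ((skew T φ hφ)^[n] p).1 = T^[n] p.1 :=
  (Function.Semiconj.iterate_right (f := Prod.fst) (ga := skew T φ hφ) (gb := T)
    (fun _ => rfl) n) p

theorem iterate_skew_symm_fst (n : ℕ) (p : X × ℝ) :
    ((skew T φ hφ).symm^[n] p).1 = T.symm^[n] p.1 :=
  (Function.Semiconj.iterate_right (f := Prod.fst) (ga := (skew T φ hφ).symm) (gb := T.symm)
    (fun _ => rfl) n) p

theorem iterate_skew_snd (n : ℕ) (x : X) (y : ℝ) :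
    ((skew T φ hφ)^[n] (x, y)).2 = y + ((skew T φ hφ)^[n] (x, 0)).2 := by
  have h : Function.Semiconj (fun p : X × ℝ => (p.1, y + p.2)) (skew T φ hφ) (skew T φ hφ) :=
    fun p => Prod.ext rfl (add_sub_assoc y p.2 (φ p.1)).symm
  simpa using (congrArg Prod.snd ((h.iterate_right n) (x, 0))).symm

theorem conservative_symm (h : Conservative T μ)
    (hq : Measure.QuasiMeasurePreserving T.symm μ μ) : Conservative T.symm μ := by
  refine ⟨hq, fun s hs h0 => ?_⟩
  obtain ⟨x, hx, m, hm, hmx⟩ := h.exists_mem_iterate_mem' hs h0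
  refine ⟨_, hmx, m, hm, ?_⟩
  rwa [Function.LeftInverse.iterate T.symm_apply_apply m]

theorem conservative'_of_skew
    (h : Conservative' (μ.prod kappa) (skew T φ hφ)) [SFinite μ] : Conservative' μ T := by
  intro A hA hpos
  obtain ⟨n, hn, hn'⟩ := h (A ×ˢ univ) (hA.prod MeasurableSet.univ) (by
    rw [Measure.prod_prod]
    exact ENNReal.mul_pos hpos.ne' kappa_univ_ne_zero)
  refine ⟨n, hn, pos_iff_ne_zero.2 fun h0 => hn'.ne' ?_⟩
  have : A ×ˢ univ ∩ (skew T φ hφ)^[n] ⁻¹' (A ×ˢ univ) = (A ∩ T^[n] ⁻¹' A) ×ˢ univ := by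
    ext p
    simp [iterate_skew_fst]
  rw [this, Measure.prod_prod, h0, zero_mul]

theorem skew_conservative' [IsFiniteMeasure μ]
    (hS : MeasurePreserving (skew T φ hφ) (μ.prod kappa) (μ.prod kappa))
    (hT : Conservative T.symm μ) : Conservative' (μ.prod kappa) (skew T φ hφ) := by
  intro W₀ hW₀ hpos
  by_contra! hwand₀
  set ν := μ.prod kappa
  set S := skew T φ hφ
  obtain ⟨a, ha⟩ : ∃ a : ℕ, ν (W₀ ∩ {p | p.2 ≤ a}) ≠ 0 := by
    by_contra! h0
    refine hpos.ne' (measure_mono_null (fun p hp => ?_) (measure_iUnion_null h0))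
    obtain ⟨a, ha⟩ := exists_nat_ge p.2
    exact mem_iUnion.2 ⟨a, hp, ha⟩
  set F : Set (X × ℝ) := {p | p.2 ≤ a} with hFdef
  have hF : MeasurableSet F := measurableSet_le measurable_snd measurable_const
  have hFfin : ν F ≠ ∞ := by
    have : F = univ ×ˢ Iic (a : ℝ) := by ext p; simp [hFdef]
    rw [this, Measure.prod_prod]
    exact ENNReal.mul_ne_top (measure_ne_top _ _) (kappa_Iic_ne_top _)
  set W := W₀ ∩ F
  have hW : MeasurableSet W := hW₀.inter hF
  have hwand (n : ℕ) (hn : 0 < n) : ν (W ∩ S^[n] ⁻¹' W) = 0 :=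
    measure_mono_null (inter_subset_inter inter_subset_left (preimage_mono inter_subset_left))
      (nonpos_iff_eq_zero.1 (hwand₀ n hn))
  -- points of `B N` drift upwards from time `N` on
  let B (N : ℕ) : Set X := ⋂ n ≥ N, {x | 0 ≤ (S^[n] (x, 0)).2}
  have hB (N : ℕ) : MeasurableSet (B N) := by
    refine MeasurableSet.iInter fun n => MeasurableSet.iInter fun _ =>
      measurableSet_le measurable_const ?_
    exact measurable_snd.comp ((S.measurable.iterate n).comp measurable_prodMk_right)
  obtain ⟨N, hN⟩ : ∃ N, ν (W ∩ Prod.fst ⁻¹' B N) ≠ 0 := by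
    by_contra! h0
    refine ha (measure_eq_zero_iff_ae_notMem.2 ?_)
    filter_upwards [ae_eventually_iterate_notMem hS hW hF hFfin hwand,
      measure_eq_zero_iff_ae_notMem.1 (measure_iUnion_null h0)] with p hp hp' hpW
    obtain ⟨N, hN⟩ := eventually_atTop.1 (hp hpW)
    refine hp' (mem_iUnion.2 ⟨N, hpW, mem_iInter₂.2 fun n hn => ?_⟩)
    have h1 : ¬ (S^[n] (p.1, p.2)).2 ≤ a := hN n hn
    have h2 : p.2 ≤ a := hpW.2
    rw [iterate_skew_snd] at h1
    change 0 ≤ (S^[n] (p.1, 0)).2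
    linarith
  set G : Set (X × ℝ) := Prod.fst ⁻¹' B N
  have hG : MeasurableSet G := measurable_fst (hB N)
  have hsum : ∑' n, ν (W ∩ S.symm^[n + N] ⁻¹' G) ≠ ∞ := by
    refine ne_top_of_le_ne_top hFfin (le_trans (ENNReal.tsum_le_tsum fun n => ?_)
      ((ENNReal.tsum_comp_le_tsum_of_injective (add_left_injective N)
        fun n => ν (S^[n] ⁻¹' W ∩ F)).trans
        (tsum_measure_iterate_preimage_inter_le hS hW hF hwand)))
    have hS' : MeasurePreserving S.symm ν ν := hS.symm S
    rw [← measure_iterate_symm_preimage_inter hS' hW hG, S.symm_symm]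
    refine measure_mono fun p hp => ⟨hp.1, ?_⟩
    have h1 : (S^[n + N] (p.1, p.2)).2 ≤ a := hp.1.2
    have h2 : 0 ≤ (S^[n + N] (p.1, 0)).2 := mem_iInter₂.1 hp.2 (n + N) (Nat.le_add_left N n)
    rw [iterate_skew_snd] at h1
    change p.2 ≤ a
    linarith
  have hrec : ∀ᵐ p ∂ν, p.1 ∈ B N → ∃ᶠ n in atTop, T.symm^[n] p.1 ∈ B N :=
    Measure.quasiMeasurePreserving_fst.ae
      (hT.ae_mem_imp_frequently_image_mem (hB N).nullMeasurableSet)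
  refine hN (measure_eq_zero_iff_ae_notMem.2 ?_)
  filter_upwards [ae_eventually_notMem hsum, hrec] with p hp hp' hpW
  refine hp' hpW.2 ((eventually_atTop.2 ?_))
  obtain ⟨M, hM⟩ := eventually_atTop.1 hp
  refine ⟨M + N, fun n hn hmem => ?_⟩
  obtain ⟨k, rfl⟩ := Nat.exists_eq_add_of_le' (le_of_add_le_right hn)
  refine hM k (by omega) ⟨hpW.1, ?_⟩
  change (S.symm^[k + N] p).1 ∈ B N
  rwa [iterate_skew_symm_fst]

end SkewProduct

/-- The skew product with the logarithm of the Radon-Nikodym derivative preserves `μ × κ`. -/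
theorem measurePreserving_maharam {X : Type*} [MeasurableSpace X] {μ : Measure X}
    [IsFiniteMeasure μ] {T : X ≃ᵐ X} (h₁ : μ.map T.symm ≪ μ) (h₂ : μ ≪ μ.map T.symm) :
    MeasurePreserving (maharam μ T) (μ.prod kappa) (μ.prod kappa) := by
  have hm : Measurable (maharam μ T) := by unfold maharam; fun_prop
  refine ⟨hm, Measure.ext fun A hA => ?_⟩
  rw [Measure.map_apply hm hA, Measure.prod_apply (hm hA), Measure.prod_apply hA]
  have hk : Measurable fun x => kappa (Prod.mk x ⁻¹' A) := measurable_measure_prodMk_left hA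
  calc ∫⁻ x, kappa (Prod.mk x ⁻¹' (maharam μ T ⁻¹' A)) ∂μ
      = ∫⁻ x, (μ.map T.symm).rnDeriv μ x * kappa (Prod.mk (T x) ⁻¹' A) ∂μ := by
        refine lintegral_congr_ae ?_
        filter_upwards [h₂.ae_le (Measure.rnDeriv_pos h₁), Measure.rnDeriv_lt_top (μ.map T.symm) μ]
          with x hx hx'
        have hsec : Prod.mk x ⁻¹' (maharam μ T ⁻¹' A) =
            (fun y => y - Real.log ((μ.map T.symm).rnDeriv μ x).toReal) ⁻¹'
              (Prod.mk (T x) ⁻¹' A) := rfl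
        rw [hsec, kappa_preimage_sub _ (measurable_prodMk_left hA),
          Real.exp_log (ENNReal.toReal_pos hx.ne' hx'.ne), ENNReal.ofReal_toReal hx'.ne]
    _ = ∫⁻ x, kappa (Prod.mk (T x) ⁻¹' A) ∂(μ.map T.symm) :=
        lintegral_rnDeriv_mul h₁ (hk.comp T.measurable).aemeasurable
    _ = ∫⁻ x, kappa (Prod.mk x ⁻¹' A) ∂μ := by
        simp [lintegral_map_equiv]

end Maharam

/-- **Maharam's theorem.** The Maharam extension `T̃` of a nonsingular transformation `T`
of a standard probability space `(X, ℬ, μ)` preserves the σ-finite measure `μ × κ`,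
`dκ(y) = e^y dy`, and `T̃` is conservative if and only if `T` is conservative. -/
theorem stmt_15 {X : Type*} [MeasurableSpace X] [StandardBorelSpace X]
    (μ : Measure X) [IsProbabilityMeasure μ] (T : X ≃ᵐ X)
    (hns : ∀ N : Set X, MeasurableSet N → (μ (⇑T ⁻¹' N) = 0 ↔ μ N = 0)) :
    (∀ A : Set (X × ℝ), MeasurableSet A →
      (μ.prod kappa) (maharam μ T ⁻¹' A) = (μ.prod kappa) A) ∧
    (Conservative' (μ.prod kappa) (maharam μ T) ↔ Conservative' μ ⇑T) := by
  have hq : Measure.QuasiMeasurePreserving T μ μ :=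
    ⟨T.measurable, Measure.AbsolutelyContinuous.mk fun N hN h0 => by
      rw [Measure.map_apply T.measurable hN]
      exact (hns N hN).2 h0⟩
  have hsymm (N : Set X) (hN : MeasurableSet N) : μ (T.symm ⁻¹' N) = 0 ↔ μ N = 0 := by
    rw [← hns _ (T.symm.measurable hN), ← preimage_comp, T.symm_comp_self, preimage_id]
  have h₁ : μ.map T.symm ≪ μ := Measure.AbsolutelyContinuous.mk fun N hN h0 => by
    rw [Measure.map_apply T.symm.measurable hN]
    exact (hsymm N hN).2 h0
  have h₂ : μ ≪ μ.map T.symm := Measure.AbsolutelyContinuous.mk fun N hN h0 => by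
    rw [Measure.map_apply T.symm.measurable hN] at h0
    exact (hsymm N hN).1 h0
  have hS := Maharam.measurePreserving_maharam h₁ h₂
  have hφ : Measurable fun x => Real.log ((μ.map T.symm).rnDeriv μ x).toReal := by fun_prop
  refine ⟨fun A hA => hS.measure_preimage hA.nullMeasurableSet,
    fun h => Maharam.conservative'_of_skew (hφ := hφ) h, fun h => ?_⟩
  refine Maharam.skew_conservative' (hφ := hφ) hS
    (Maharam.conservative_symm ⟨hq, fun s hs h0 => ?_⟩ ⟨T.symm.measurable, h₁⟩)
  obtain ⟨n, hn, hpos⟩ := h s hs (pos_iff_ne_zero.2 h0)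
  obtain ⟨x, hx, hx'⟩ := nonempty_of_measure_ne_zero hpos.ne'
  exact ⟨x, hx, n, hn.ne', hx'⟩
end

section
/- (Silva–Thieullen) Let T be a nonsingular K-automorphism of a standard probability space (X, ℬ, μ), i.e. there exists a sub-σ-algebra 𝓕 ⊆ ℬ such that T⁻¹𝓕 ⊆ 𝓕, ⋂_{k≥0} T⁻ᵏ𝓕 = {∅, X} mod μ, ⋁_{k≥0} Tᵏ𝓕 = ℬ mod μ, and d(μ∘T)/dμ is 𝓕-measurable. Then T is either totally dissipative (its conservative part is null) or ergodic. -/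
open MeasureTheory Set Filter ENNReal

/-- `W` is a *wandering* set for `T`. -/
def Wandering' {X : Type*} (T : X → X) (W : Set X) : Prop :=
  ∀ i j : ℕ, i ≠ j → T^[i] ⁻¹' W ∩ T^[j] ⁻¹' W = ∅

/-- `T` is *totally dissipative*: its conservative part is null, equivalently `X` is
covered, up to a null set, by countably many wandering sets. -/
def TotallyDissipative {X : Type*} [MeasurableSpace X] (μ : Measure X) (T : X → X) : Prop :=
  ∃ W : ℕ → Set X, (∀ n, MeasurableSet (W n) ∧ Wandering' T (W n)) ∧ μ ((⋃ n, W n)ᶜ) = 0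

namespace NonsingularK

variable {X : Type*}

/-- The density of `μ ∘ T ^ n` with respect to `μ`, when `h` is that of `μ ∘ T`. -/
noncomputable def cocycle (T : X → X) (h : X → ℝ≥0∞) : ℕ → X → ℝ≥0∞
  | 0, _ => 1
  | n + 1, x => h x * cocycle T h n (T x)

theorem measurable_cocycle {F : MeasurableSpace X} {T : X → X} {h : X → ℝ≥0∞}
    (hT : Measurable T) (hh : Measurable h) (n : ℕ) : Measurable (cocycle T h n) := by
  induction n with
  | zero => exact measurable_const
  | succ n ih => exact hh.mul (ih.comp hT)

theorem measurable_tsum_cocycle {F : MeasurableSpace X} {T : X → X} {h : X → ℝ≥0∞}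
    (hT : Measurable T) (hh : Measurable h) : Measurable fun x => ∑' n, cocycle T h n x :=
  Measurable.tsum (measurable_cocycle hT hh)

theorem tsum_cocycle (T : X → X) (h : X → ℝ≥0∞) (x : X) :
    ∑' n, cocycle T h n x = 1 + h x * ∑' n, cocycle T h n (T x) := by
  rw [tsum_eq_zero_add' ENNReal.summable]
  simp only [cocycle, ENNReal.tsum_mul_left]

theorem lintegral_comp_iterate_mul_cocycle {m0 : MeasurableSpace X} {μ : Measure X} {T : X → X}
    {h : X → ℝ≥0∞} (hT : Measurable T) (hh : Measurable h)
    (hint : ∀ φ : X → ℝ≥0∞, Measurable φ → ∫⁻ x, h x * φ (T x) ∂μ = ∫⁻ x, φ x ∂μ)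
    (n : ℕ) {φ : X → ℝ≥0∞} (hφ : Measurable φ) :
    ∫⁻ x, cocycle T h n x * φ (T^[n] x) ∂μ = ∫⁻ x, φ x ∂μ := by
  induction n with
  | zero => simp [cocycle]
  | succ n ih =>
    have hm : Measurable fun x => cocycle T h n x * φ (T^[n] x) :=
      (measurable_cocycle hT hh n).mul (hφ.comp (hT.iterate n))
    rw [← ih, ← hint _ hm]
    simp only [cocycle, Function.iterate_succ_apply, mul_assoc]

/-- The conditional probability of `A` given `F`. -/
theorem exists_conditional_density (F : MeasurableSpace X) [m0 : MeasurableSpace X]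
    (μ : Measure X) [IsProbabilityMeasure μ] (hF : F ≤ m0) (A : Set X) :
    ∃ g : X → NNReal, Measurable[F] g ∧ (∀ x, g x ≤ 1) ∧
      ∀ φ : X → ℝ≥0∞, Measurable[F] φ → ∫⁻ x, φ x * g x ∂μ = ∫⁻ x in A, φ x ∂μ := by
  set ν := (μ.restrict A).trim hF with hν
  have hle : ν ≤ μ.trim hF := Measure.le_iff.2 fun s hs => by
    rw [hν, trim_measurableSet_eq hF hs, trim_measurableSet_eq hF hs]
    exact Measure.restrict_apply_le _ _
  have hg : Measurable[F] (ν.rnDeriv (μ.trim hF)) := Measure.measurable_rnDeriv _ _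
  have h1 := Measure.rnDeriv_le_one_of_le hle
  refine ⟨fun x => (min (ν.rnDeriv (μ.trim hF) x) 1).toNNReal,
    (hg.min measurable_const).ennreal_toNNReal, fun x => ?_, fun φ hφ => ?_⟩
  · exact ENNReal.toNNReal_mono one_ne_top (min_le_right _ _)
  · have : ∀ᵐ x ∂μ, φ x * ((min (ν.rnDeriv (μ.trim hF) x) 1).toNNReal : ℝ≥0∞)
        = ν.rnDeriv (μ.trim hF) x * φ x := by
      filter_upwards [ae_of_ae_trim hF h1] with x hx
      have hx : ν.rnDeriv (μ.trim hF) x ≤ 1 := hx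
      rw [min_eq_left hx, ENNReal.coe_toNNReal (ne_top_of_le_ne_top one_ne_top hx), mul_comm]
    rw [lintegral_congr_ae this, ← lintegral_trim hF (hg.fun_mul hφ), ← lintegral_trim hF hφ, ← hν,
      ← Measure.withDensity_rnDeriv_eq _ _ (Measure.absolutelyContinuous_of_le hle),
      @lintegral_withDensity_eq_lintegral_mul _ F _ _ hg _ hφ]
    simp [Measure.withDensity_rnDeriv_eq _ _ (Measure.absolutelyContinuous_of_le hle)]

/-- In the conservative case the conditional probability of an invariant set is invariant. -/
theorem conditional_density_comp_ae_eq (F : MeasurableSpace X) [m0 : MeasurableSpace X]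
    (μ : Measure X) [IsProbabilityMeasure μ] (hF : F ≤ m0) {T : X → X}
    (hT : Measurable T) (hTF : Measurable[F, F] T) {h : X → ℝ≥0∞} (hh : Measurable[F] h)
    (hint : ∀ φ : X → ℝ≥0∞, Measurable φ → ∫⁻ x, h x * φ (T x) ∂μ = ∫⁻ x, φ x ∂μ)
    (hcons : ∀ᵐ x ∂μ, ∑' n, cocycle T h n x = ∞)
    {A : Set X} (hA : MeasurableSet A) (hTA : T ⁻¹' A = A)
    {g : X → NNReal} (hg : Measurable[F] g) (hg1 : ∀ x, g x ≤ 1)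
    (hgA : ∀ φ : X → ℝ≥0∞, Measurable[F] φ → ∫⁻ x, φ x * g x ∂μ = ∫⁻ x in A, φ x ∂μ) :
    g ∘ T =ᵐ[μ] g := by
  have hh0 : Measurable h := hh.mono hF le_rfl
  have hg0 : Measurable g := hg.mono hF le_rfl
  have hwF : ∀ n, Measurable[F] (cocycle T h n) := measurable_cocycle hTF hh
  have hw : ∀ n, Measurable (cocycle T h n) := fun n => (hwF n).mono hF le_rfl
  set d : X → ℝ≥0∞ := fun x => ((nndist (g x) (g (T x)) ^ 2 : NNReal) : ℝ≥0∞) with hd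
  have hdm : Measurable d := by
    exact ((hg0.nndist (hg0.comp hT)).pow_const 2).coe_nnreal_ennreal
  set a : ℕ → ℝ≥0∞ := fun n => ∫⁻ x, cocycle T h n x * (g x * g x) ∂μ with ha
  have ha1 : ∀ n, a n ≤ 1 := fun n => by
    calc a n ≤ ∫⁻ x, cocycle T h n x * 1 ∂μ := by
          refine lintegral_mono fun x => ?_
          gcongr
          exact mul_le_one' (ENNReal.coe_le_one_iff.2 (hg1 x)) (ENNReal.coe_le_one_iff.2 (hg1 x))
      _ = 1 := by
          simpa using lintegral_comp_iterate_mul_cocycle hT hh0 hint n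
            (measurable_const (a := (1 : ℝ≥0∞)))
  have hcross : ∀ n, ∫⁻ x, cocycle T h (n + 1) x * (g (T x) * g x) ∂μ = a n := fun n => by
    have e1 : Measurable[F] fun x => cocycle T h (n + 1) x * (g (T x) : ℝ≥0∞) :=
      (hwF _).mul (hg.comp hTF).coe_nnreal_ennreal
    have e2 : Measurable[F] fun x => cocycle T h n x * (g x : ℝ≥0∞) :=
      (hwF _).mul hg.coe_nnreal_ennreal
    simp only [ha, ← mul_assoc]
    rw [hgA _ e1, hgA _ e2, ← lintegral_indicator hA, ← lintegral_indicator hA,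
      ← hint _ ((e2.mono hF le_rfl).indicator hA)]
    refine lintegral_congr fun x => ?_
    have hx : T x ∈ A ↔ x ∈ A := by rw [← mem_preimage, hTA]
    by_cases hxA : x ∈ A <;> simp [hx, hxA, cocycle, mul_assoc]
  have hshift : ∀ n, ∫⁻ x, cocycle T h (n + 1) x * (g (T x) * g (T x)) ∂μ = a n := fun n => by
    have e : Measurable fun x => cocycle T h n x * ((g x : ℝ≥0∞) * g x) :=
      (hw n).mul (hg0.coe_nnreal_ennreal.mul hg0.coe_nnreal_ennreal)
    simp only [ha, ← hint _ e, cocycle, mul_assoc]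
  have hsq : ∀ x, d x + (g (T x) * g x + g (T x) * g x) = g x * g x + g (T x) * g (T x) := by
    intro x
    simp only [hd]
    norm_cast
    apply NNReal.coe_injective
    push_cast
    rw [NNReal.dist_eq, sq_abs]
    ring
  have hstep : ∀ n, ∫⁻ x, cocycle T h (n + 1) x * d x ∂μ + a n = a (n + 1) := fun n => by
    have hcc : Measurable fun x => cocycle T h (n + 1) x * ((g (T x) : ℝ≥0∞) * g x) :=
      (hw _).mul ((hg0.comp hT).coe_nnreal_ennreal.mul hg0.coe_nnreal_ennreal)
    have hgg : Measurable fun x => cocycle T h (n + 1) x * ((g x : ℝ≥0∞) * g x) :=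
      (hw _).mul (hg0.coe_nnreal_ennreal.mul hg0.coe_nnreal_ennreal)
    have key : ∫⁻ x, cocycle T h (n + 1) x * d x ∂μ + (a n + a n) = a (n + 1) + a n := by
      conv_lhs => rw [← hcross n]
      conv_rhs => rw [← hshift n]
      rw [← lintegral_add_left hcc, ← lintegral_add_left ((hw _).fun_mul hdm),
        ← lintegral_add_left hgg]
      refine lintegral_congr fun x => ?_
      simp only [← mul_add]
      rw [mul_add (g (T x) : ℝ≥0∞), hsq]
    rw [← add_assoc] at key
    exact (ENNReal.add_left_inj (ne_top_of_le_ne_top one_ne_top (ha1 n))).1 key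
  have hsum : ∀ N, ∑ n ∈ Finset.range N, ∫⁻ x, cocycle T h (n + 1) x * d x ∂μ + a 0 = a N := by
    intro N
    induction N with
    | zero => simp
    | succ N ih => rw [Finset.sum_range_succ, add_right_comm, ih, add_comm, hstep]
  have hfin : ∫⁻ x, (∑' n, cocycle T h (n + 1) x) * d x ∂μ ≤ 1 := by
    simp only [← ENNReal.tsum_mul_right]
    rw [lintegral_tsum fun n => ((hw _).fun_mul hdm).aemeasurable]
    exact ENNReal.tsum_le_of_sum_range_le fun N => le_self_add.trans ((hsum N).trans_le (ha1 N))
  have hfin' : ∀ᵐ x ∂μ, (∑' n, cocycle T h (n + 1) x) * d x < ∞ :=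
    ae_lt_top ((Measurable.tsum fun n => hw _).mul hdm)
      (ne_top_of_le_ne_top one_ne_top hfin)
  filter_upwards [hfin', hcons] with x hx hc
  have htop : ∑' n, cocycle T h (n + 1) x = ∞ := by
    rw [tsum_eq_zero_add' ENNReal.summable] at hc
    simpa [cocycle] using hc
  have hd0 : d x = 0 := by
    by_contra hne
    rw [htop, ENNReal.top_mul hne] at hx
    exact lt_irrefl _ hx
  have : nndist (g x) (g (T x)) = 0 := by simpa [hd] using hd0
  exact (nndist_eq_zero.1 this).symm

/-- In the conservative case, if the factor `F` is ergodic, then invariant sets are independent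
of `F`. -/
theorem indep_invariants_of_conservative (F : MeasurableSpace X) [m0 : MeasurableSpace X]
    (μ : Measure X) [IsProbabilityMeasure μ] (hF : F ≤ m0) {T : X → X}
    (hT : Measure.QuasiMeasurePreserving T μ μ) (hTF : Measurable[F, F] T)
    (herg : ∀ A, MeasurableSet[F] A → T ⁻¹' A = A → μ A = 0 ∨ μ Aᶜ = 0)
    {h : X → ℝ≥0∞} (hh : Measurable[F] h)
    (hint : ∀ φ : X → ℝ≥0∞, Measurable φ → ∫⁻ x, h x * φ (T x) ∂μ = ∫⁻ x, φ x ∂μ)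
    (hcons : ∀ᵐ x ∂μ, ∑' n, cocycle T h n x = ∞) :
    ProbabilityTheory.Indep F (MeasurableSpace.invariants T) μ := by
  rw [ProbabilityTheory.Indep_iff]
  rintro B A hB hA
  obtain ⟨hA, hTA⟩ := MeasurableSpace.measurableSet_invariants.1 hA
  obtain ⟨g, hg, hg1, hgA⟩ := exists_conditional_density F μ hF A
  have hinv := conditional_density_comp_ae_eq F μ hF hT.measurable hTF hh hint hcons hA hTA
    hg hg1 hgA
  have hq : @QuasiErgodic X F T (μ.trim hF) :=
    { measurable := hTF
      absolutelyContinuous := by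
        refine Measure.AbsolutelyContinuous.mk fun s hs h0 => ?_
        rw [Measure.map_apply hTF hs, trim_measurableSet_eq hF (hTF hs)]
        rw [trim_measurableSet_eq hF hs] at h0
        exact hT.preimage_null h0
      aeconst_set := fun s hs hTs => by
        rw [eventuallyConst_set']
        refine (herg s hs hTs).imp (fun h0 => ?_) fun h0 => ?_
        · exact ae_eq_empty.2 ((trim_measurableSet_eq hF hs).trans h0)
        · exact ae_eq_univ.2 ((trim_measurableSet_eq hF hs.compl).trans h0) }
  have htrim : g ∘ T =ᵐ[μ.trim hF] g :=
    
    (StronglyMeasurable.ae_eq_trim_iff hF (hg.comp hTF).stronglyMeasurable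
      hg.stronglyMeasurable).2 hinv
  obtain ⟨c, hc⟩ := @QuasiErgodic.ae_eq_const_of_ae_eq_comp_ae X NNReal F (μ.trim hF) _ _ _ T g hq
    hg.stronglyMeasurable.aestronglyMeasurable htrim
  have hc' : g =ᵐ[μ] fun _ => c := ae_eq_of_ae_eq_trim hc
  have hcA : ∀ S, MeasurableSet[F] S → μ (S ∩ A) = μ S * c := fun S hS => by
    have := hgA (S.indicator 1) ((@measurable_one ℝ≥0∞ X _ F _).indicator hS)
    rw [lintegral_indicator_one (hF _ hS), Measure.restrict_apply (hF _ hS)] at this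
    rw [← this, lintegral_congr_ae (g := fun x => S.indicator 1 x * (c : ℝ≥0∞))
      (by filter_upwards [hc'] with x hx; rw [hx]),
      lintegral_mul_const _ (measurable_one.indicator (hF _ hS)),
      lintegral_indicator_one (hF _ hS)]
  have hcu : μ A = c := by simpa using hcA univ MeasurableSet.univ
  rw [hcA B hB, hcu]

/-- A set that almost every point visits finitely often in backward time is covered by countably many
wandering sets. -/
theorem exists_wandering_cover [MeasurableSpace X] {μ : Measure X} (T : X ≃ᵐ X)
    {B : Set X} (hB : MeasurableSet B) (hfin : ∑' n, μ (T.symm^[n] ⁻¹' B) ≠ ∞) :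
    ∃ W : ℕ → Set X, (∀ n, MeasurableSet (W n) ∧ Wandering' T (W n)) ∧
      ∀ᵐ x ∂μ, x ∈ B → x ∈ ⋃ n, W n := by
  have hTT : ∀ n : ℕ, Function.LeftInverse T.symm^[n] T^[n] := fun n =>
    Function.LeftInverse.iterate T.symm_apply_apply n
  have hcomm : Function.Commute T.symm T := fun x => by simp
  set V : Set X := B ∩ ⋂ n : ℕ, (T.symm^[n + 1] ⁻¹' B)ᶜ with hV
  have hm : ∀ n : ℕ, Measurable T.symm^[n] := fun n => T.symm.measurable.iterate n
  have hVm : MeasurableSet V :=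
    hB.inter (MeasurableSet.iInter fun n => (hm _ hB).compl)
  have hVlt : ∀ i k x, T^[i] x ∈ V → T^[i + (k + 1)] x ∉ V := fun i k x hi hk => by
    have := mem_iInter.1 hk.2 k
    rw [add_comm i, Function.iterate_add_apply] at this
    exact this (by rw [mem_preimage, hTT]; exact hi.1)
  have hVne : ∀ i j x, i < j → T^[i] x ∈ V → T^[j] x ∉ V := fun i j x hij hi => by
    obtain ⟨k, rfl⟩ := Nat.exists_eq_add_of_lt hij
    exact hVlt i k x hi
  refine ⟨fun n => T.symm^[n] ⁻¹' V, fun n => ⟨hm n hVm, fun i j hij => ?_⟩, ?_⟩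
  · refine eq_empty_of_forall_notMem fun x hx => ?_
    have hi : T^[i] (T.symm^[n] x) ∈ V := by
      rw [← ((hcomm.iterate_left n).iterate_right i) x]; exact hx.1
    have hj : T^[j] (T.symm^[n] x) ∈ V := by
      rw [← ((hcomm.iterate_left n).iterate_right j) x]; exact hx.2
    exact hij.lt_or_gt.elim (fun h => hVne i j _ h hi hj) fun h => hVne j i _ h hj hi
  · filter_upwards [ae_eventually_notMem hfin] with x hx hxB
    classical
    obtain ⟨N, hN⟩ := eventually_atTop.1 hx
    set n := Nat.findGreatest (fun k => T.symm^[k] x ∈ B) N with hn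
    have hnB : T.symm^[n] x ∈ B :=
      Nat.findGreatest_spec (P := fun k => T.symm^[k] x ∈ B) (Nat.zero_le N) hxB
    refine mem_iUnion.2 ⟨n, hnB, mem_iInter.2 fun k hk => ?_⟩
    rw [mem_preimage, ← Function.iterate_add_apply] at hk
    rcases le_or_gt (k + 1 + n) N with hle | hgt
    · have := Nat.le_findGreatest (P := fun k => T.symm^[k] x ∈ B) hle hk
      omega
    · exact hN _ hgt.le hk

/-- If the sum of the densities is a.e. finite then `T` is totally dissipative. -/
theorem totallyDissipative_of_tsum_cocycle_ne_top [MeasurableSpace X] (μ : Measure X)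
    [IsProbabilityMeasure μ] (T : X ≃ᵐ X) {h : X → ℝ≥0∞} (hh : Measurable h)
    (hint : ∀ φ : X → ℝ≥0∞, Measurable φ → ∫⁻ x, h x * φ (T x) ∂μ = ∫⁻ x, φ x ∂μ)
    (hdiss : ∀ᵐ x ∂μ, ∑' n, cocycle T h n x ≠ ∞) : TotallyDissipative μ T := by
  have hw : ∀ n, Measurable (cocycle T h n) := measurable_cocycle T.measurable hh
  have hS : Measurable fun x => ∑' n, cocycle T h n x :=
    measurable_tsum_cocycle T.measurable hh
  set B : ℕ → Set X := fun m => {x | ∑' n, cocycle T h n x ≤ m} with hBdef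
  have hB : ∀ m, MeasurableSet (B m) := fun m => measurableSet_le hS measurable_const
  have hfin : ∀ m, ∑' n, μ (T.symm^[n] ⁻¹' B m) ≠ ∞ := fun m => by
    have e : ∀ n : ℕ, μ (T.symm^[n] ⁻¹' B m) = ∫⁻ x in B m, cocycle T h n x ∂μ := fun n => by
      have hpre : MeasurableSet (T.symm^[n] ⁻¹' B m) := T.symm.measurable.iterate n (hB m)
      rw [← lintegral_indicator_one hpre, ← lintegral_indicator (hB m),
        ← lintegral_comp_iterate_mul_cocycle T.measurable hh hint n
          (measurable_one.indicator hpre)]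
      refine lintegral_congr fun x => ?_
      have hx : T.symm^[n] (T^[n] x) = x :=
        Function.LeftInverse.iterate T.symm_apply_apply n x
      by_cases hxB : x ∈ B m <;> simp [indicator, hx, hxB]
    simp only [e]
    rw [← lintegral_tsum fun n => (hw n).aemeasurable]
    refine ne_top_of_le_ne_top (ENNReal.natCast_ne_top m) ?_
    calc ∫⁻ x in B m, ∑' n, cocycle T h n x ∂μ ≤ ∫⁻ _ in B m, (m : ℝ≥0∞) ∂μ :=
          setLIntegral_mono measurable_const fun x hx => hx
      _ ≤ m := by
          rw [setLIntegral_const]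
          exact mul_le_of_le_one_right' prob_le_one
  choose W hW hcov using fun m => exists_wandering_cover T (hB m) (hfin m)
  refine ⟨fun k => W k.unpair.1 k.unpair.2, fun k => hW _ _, ?_⟩
  change ∀ᵐ x ∂μ, x ∈ ⋃ k : ℕ, W k.unpair.1 k.unpair.2
  filter_upwards [hdiss, ae_all_iff.2 hcov] with x hx hxc
  obtain ⟨m, hm⟩ := ENNReal.exists_nat_gt hx
  obtain ⟨n, hn⟩ := mem_iUnion.1 (hxc m hm.le)
  exact mem_iUnion.2 ⟨Nat.pair m n, by simpa using hn⟩

/-- A strictly positive, finite, `F`-measurable version of the density of `μ ∘ T`. -/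
theorem exists_density (F : MeasurableSpace X) [m0 : MeasurableSpace X]
    (μ : Measure X) [IsProbabilityMeasure μ] (T : X ≃ᵐ X)
    (hns : QuasiInvariant' μ T)
    (hrn : ∃ h : X → ℝ≥0∞, @Measurable X ℝ≥0∞ F _ h ∧
        (μ.map T.symm).rnDeriv μ =ᵐ[μ] h) :
    ∃ h : X → ℝ≥0∞, Measurable[F] h ∧ (∀ x, h x ≠ 0) ∧ (∀ x, h x ≠ ∞) ∧
      ∀ φ : X → ℝ≥0∞, Measurable φ → ∫⁻ x, h x * φ (T x) ∂μ = ∫⁻ x, φ x ∂μ := by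
  obtain ⟨h, hh, hhr⟩ := hrn
  have hprob : IsProbabilityMeasure (μ.map T.symm) :=
    Measure.isProbabilityMeasure_map T.symm.measurable.aemeasurable
  have hac : μ.map T.symm ≪ μ := Measure.AbsolutelyContinuous.mk fun s hs h0 => by
    rw [Measure.map_apply T.symm.measurable hs]
    refine (hns _ (T.symm.measurable hs)).1 ?_
    rwa [← preimage_comp, MeasurableEquiv.symm_comp_self, preimage_id]
  have hac' : μ ≪ μ.map T.symm := Measure.AbsolutelyContinuous.mk fun s hs h0 => by
    rw [Measure.map_apply T.symm.measurable hs] at h0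
    have := (hns _ (T.symm.measurable hs)).2 h0
    rwa [← preimage_comp, MeasurableEquiv.symm_comp_self, preimage_id] at this
  have hpos : ∀ᵐ x ∂μ, h x ≠ 0 := by
    filter_upwards [hhr, hac'.ae_le (Measure.rnDeriv_pos hac)] with x hx hx0
    rw [← hx]
    exact hx0.ne'
  have hlt : ∀ᵐ x ∂μ, h x ≠ ∞ := by
    filter_upwards [hhr, (μ.map T.symm).rnDeriv_lt_top μ] with x hx hx0
    rw [← hx]
    exact hx0.ne
  classical
  have hE : MeasurableSet[F] {x | h x = 0 ∨ h x = ∞} :=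
    @MeasurableSet.union _ F _ _ (hh (measurableSet_singleton 0))
      (hh (measurableSet_singleton ∞))
  have hm : Measurable[F] fun x => if h x = 0 ∨ h x = ∞ then 1 else h x :=
    Measurable.ite (m := F) hE (@measurable_const ℝ≥0∞ X _ F 1) hh
  refine ⟨_, hm, fun x => ?_, fun x => ?_, fun φ hφ => ?_⟩
  · split_ifs with hx
    · exact one_ne_zero
    · tauto
  · split_ifs with hx
    · exact one_ne_top
    · tauto
  · have hrm := Measure.measurable_rnDeriv (μ.map T.symm) μ
    have hφT : Measurable fun x => φ (T x) := hφ.comp T.measurable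
    calc _ = ∫⁻ x, ((μ.map T.symm).rnDeriv μ * fun x => φ (T x)) x ∂μ := by
          refine lintegral_congr_ae ?_
          filter_upwards [hhr, hpos, hlt] with x hx h0 h1
          simp [h0, h1, hx]
      _ = ∫⁻ x, φ x ∂μ := by
          rw [← lintegral_withDensity_eq_lintegral_mul _ hrm hφT,
            Measure.withDensity_rnDeriv_eq _ _ hac, lintegral_map hφT T.symm.measurable]
          simp

end NonsingularK

open NonsingularK

/-- **Silva–Thieullen.** A nonsingular K-automorphism — a nonsingular `T` admitting a
sub-σ-algebra `𝓕 ⊆ ℬ` with `T⁻¹𝓕 ⊆ 𝓕`, `⋂_{k≥0} T⁻ᵏ𝓕 = {∅, X}` mod `μ`,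
`⋁_{k≥0} Tᵏ𝓕 = ℬ` mod `μ`, and `d(μ∘T)/dμ` being `𝓕`-measurable — is either totally
dissipative or ergodic. -/
theorem stmt_17 {X : Type*} (F : MeasurableSpace X)
    [m0 : MeasurableSpace X] [StandardBorelSpace X]
    (μ : Measure X) [IsProbabilityMeasure μ] (T : X ≃ᵐ X)
    (hns : QuasiInvariant' μ ⇑T)
    (hF : F ≤ m0)
    (hinv : ∀ A : Set X, MeasurableSet[F] A → MeasurableSet[F] (⇑T ⁻¹' A))
    (htail : ∀ A : Set X,
      (∀ k : ℕ, ∃ B : Set X, MeasurableSet[F] B ∧ A = (⇑T)^[k] ⁻¹' B) →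
      μ A = 0 ∨ μ Aᶜ = 0)
    (hgen : ∀ A : Set X, MeasurableSet A →
      ∃ B : Set X,
        MeasurableSet[⨆ k : ℕ, MeasurableSpace.comap ((⇑T.symm)^[k]) F] B ∧
        μ (symmDiff A B) = 0)
    (hrn : ∃ h : X → ℝ≥0∞, @Measurable X ℝ≥0∞ F _ h ∧
        (μ.map ⇑T.symm).rnDeriv μ =ᵐ[μ] h) :
    TotallyDissipative μ ⇑T ∨ Ergodic' μ ⇑T := by
  obtain ⟨h, hh, h0, h1, hint⟩ := exists_density F μ T hns hrn
  have hTF : Measurable[F, F] T := fun A hA => hinv A hA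
  have hTsT : ∀ k : ℕ, Function.LeftInverse T.symm^[k] T^[k] := fun k =>
    Function.LeftInverse.iterate T.symm_apply_apply k
  have hTTs : ∀ k : ℕ, Function.LeftInverse T^[k] T.symm^[k] := fun k =>
    Function.LeftInverse.iterate T.apply_symm_apply k
  have hpre : ∀ A : Set X, T ⁻¹' A = A → ∀ k : ℕ, T^[k] ⁻¹' A = A := fun A hA k => by
    rw [preimage_iterate_eq]; exact Function.iterate_fixed hA k
  have herg : ∀ A, MeasurableSet[F] A → T ⁻¹' A = A → μ A = 0 ∨ μ Aᶜ = 0 := fun A hA hTA =>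
    htail A fun k => ⟨A, hA, (hpre A hTA k).symm⟩
  have hSm : Measurable[F] fun x => ∑' n, cocycle T h n x :=
    measurable_tsum_cocycle hTF hh
  have hSinv : ⇑T ⁻¹' {x | ∑' n, cocycle T h n x = ∞} = {x | ∑' n, cocycle T h n x = ∞} := by
    ext x
    simp [tsum_cocycle _ _ x, ENNReal.mul_eq_top, h0, h1]
  rcases herg _ (hSm (measurableSet_singleton ∞)) hSinv with hC | hC
  · exact Or.inl (totallyDissipative_of_tsum_cocycle_ne_top μ T (hh.mono hF le_rfl) hint
      (measure_eq_zero_iff_ae_notMem.1 hC))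
  right
  intro A hA hTA
  set G : ℕ → MeasurableSpace X := fun k => MeasurableSpace.comap T.symm^[k] F with hG
  have hq : Measure.QuasiMeasurePreserving T μ μ :=
    ⟨T.measurable, Measure.AbsolutelyContinuous.mk fun s hs hs0 => by
      rw [Measure.map_apply T.measurable hs]; exact (hns s hs).2 hs0⟩
  have hG_le : ∀ k, G k ≤ m0 := fun k =>
    ((T.symm.measurable.iterate k).comap_le).trans' (MeasurableSpace.comap_mono hF)
  have hF_le : ∀ k, F ≤ G k := fun k B hB =>
    ⟨T^[k] ⁻¹' B, hTF.iterate k hB, by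
      rw [← preimage_comp, (hTTs k).comp_eq_id, preimage_id]⟩
  have hG_mono : Monotone G := monotone_nat_of_le_succ fun k => by
    rintro _ ⟨B, hB, rfl⟩
    refine ⟨T ⁻¹' B, hTF hB, ?_⟩
    ext x
    rw [mem_preimage, mem_preimage, mem_preimage, Function.iterate_succ_apply',
      T.apply_symm_apply]
  have hG_inv : ∀ k, Measurable[G k, G k] T := fun k => by
    rintro _ ⟨B, hB, rfl⟩
    refine ⟨T ⁻¹' B, hTF hB, ?_⟩
    have hcomm : Function.Commute T.symm T := fun x => by simp
    ext x
    rw [mem_preimage, mem_preimage, mem_preimage, mem_preimage, (hcomm.iterate_left k) x]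
  have hG_erg : ∀ k, ∀ B, MeasurableSet[G k] B → T ⁻¹' B = B → μ B = 0 ∨ μ Bᶜ = 0 := by
    rintro k _ ⟨B, hB, rfl⟩ hTB
    have : T.symm^[k] ⁻¹' B = B := by
      rw [← hpre _ hTB k, ← preimage_comp, (hTsT k).comp_eq_id, preimage_id]
    rw [this] at hTB ⊢
    exact herg B hB hTB
  have hind : ProbabilityTheory.Indep (⨆ k, G k) (MeasurableSpace.invariants T) μ :=
    ProbabilityTheory.indep_iSup_of_monotone
      (fun k => indep_invariants_of_conservative (G k) μ (hG_le k) hq (hG_inv k) (hG_erg k)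
        (hh.mono (hF_le k) le_rfl) hint (mem_ae_iff.2 hC))
      hG_le (MeasurableSpace.invariants_le T) hG_mono
  obtain ⟨B, hB, hAB⟩ := hgen A hA
  have hAB' : A =ᵐ[μ] B := measure_symmDiff_eq_zero_iff.1 hAB
  have hBA := (ProbabilityTheory.Indep_iff _ _ _).1 hind B A hB
    (MeasurableSpace.measurableSet_invariants.2 ⟨hA, hTA⟩)
  rw [measure_congr (hAB'.symm.inter (ae_eq_refl A)), inter_self, ← measure_congr hAB'] at hBA
  rw [prob_compl_eq_zero_iff hA]
  by_contra! hne
  exact hne.2 ((ENNReal.mul_eq_left hne.1 (measure_ne_top μ A)).1 hBA.symm)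
end
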